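/- For every decorated tree τ there exist real constants {c_n(τ,τ') : τ' ⪯ τ, n ≥ 2} with c_n(τ,τ) > 0, not depending on the seed, such that for every seed tree S with |S| = n₀ ≥ 2, the process M_τ^{(S)}(n) = Σ_{τ' ⪯ τ} c_n(τ,τ') · D_{τ'}(T_n^{(S)}), defined for n ≥ n₀, is a martingale with respect to the filtration F_n = σ(T_{n₀}^{(S)},…,T_n^{(S)}) and is bounded in L². -/

import Mathlib

open Finset

noncomputable section

namespace LPAM

attribute [local instance] Classical.propDecidable

/-- The tree obtained from `G` by attaching a new vertex (the last element of `Fin (n+1)`)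
to the vertex `v` of `G`. -/
def attach {n : ℕ} (G : SimpleGraph (Fin n)) (v : Fin n) : SimpleGraph (Fin (n + 1)) :=
  SimpleGraph.fromRel fun a b =>
    (∃ a' b' : Fin n, a = a'.castSucc ∧ b = b'.castSucc ∧ G.Adj a' b') ∨
    (a = Fin.last n ∧ b = v.castSucc)

/-- The degree of a vertex. -/
def deg {n : ℕ} (G : SimpleGraph (Fin n)) (v : Fin n) : ℕ := (G.neighborSet v).ncard

/-- The law of the linear preferential attachment tree after `k` steps started from the
seed `S`: at each step, a new vertex is joined by an edge to a random vertex of the current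
tree chosen with probability proportional to its degree. -/
def law {n₀ : ℕ} (S : SimpleGraph (Fin n₀)) : (k : ℕ) → SimpleGraph (Fin (n₀ + k)) → ℝ
  | 0, G => if G = S then 1 else 0
  | (k + 1), G =>
      ∑ H : SimpleGraph (Fin (n₀ + k)), ∑ v : Fin (n₀ + k),
        law S k H * ((deg H v : ℝ) / (2 * (n₀ + k : ℕ) - 2)) *
          (if attach H v = G then 1 else 0)

/-- The law of the preferential attachment tree `T_n^{(S)}` with seed `S`, as a function on
graphs on `Fin n` (zero if `n < |S|`). -/
def lawAt {n₀ : ℕ} (S : SimpleGraph (Fin n₀)) (n : ℕ) (G : SimpleGraph (Fin n)) : ℝ :=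
  if h : n₀ ≤ n then
    law S (n - n₀) (cast (congrArg (fun m => SimpleGraph (Fin m)) (Nat.add_sub_cancel' h).symm) G)
  else 0

/-- A decorated tree: a finite tree together with a positive integer label on each vertex. -/
structure DecTree where
  n : ℕ
  graph : SimpleGraph (Fin n)
  isTree : graph.IsTree
  label : Fin n → ℕ
  label_pos : ∀ u, 0 < label u

/-- The weight of a decorated tree: the sum of its labels. -/
def DecTree.weight (τ : DecTree) : ℕ := ∑ u, τ.label u

/-- The strict partial order `≺` on decorated trees. -/
def DecTree.lt (τ' τ : DecTree) : Prop :=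
  (τ'.weight < τ.weight ∧ τ'.n ≤ τ.n) ∨ (τ'.weight = τ.weight ∧ τ'.n < τ.n)

/-- The partial order `⪯` associated with `≺`. -/
def DecTree.le (τ' τ : DecTree) : Prop := DecTree.lt τ' τ ∨ τ' = τ

/-- The observable `D_τ(T) = ∑_φ ∏_{u ∈ τ} [deg_T φ(u)]_{ℓ(u)}`, the sum running over all
embeddings (injective graph homomorphisms) `φ : τ → T`. -/
def Dval (τ : DecTree) {m : ℕ} (T : SimpleGraph (Fin m)) : ℝ :=
  ∑ φ : Fin τ.n → Fin m,
    if Function.Injective φ ∧ ∀ a b, τ.graph.Adj a b → T.Adj (φ a) (φ b) then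
      ∏ u, ((deg T (φ u)).descFactorial (τ.label u) : ℝ)
    else 0

/-- The expectation `E[D_τ(T_n^{(S)})]`. -/
def expD {n₀ : ℕ} (S : SimpleGraph (Fin n₀)) (τ : DecTree) (n : ℕ) : ℝ :=
  ∑ G : SimpleGraph (Fin n), lawAt S n G * Dval τ G

/-- `a ≪ b` : there are `c > 0` and `γ ∈ ℝ` with `|a_n| ≤ c (log n)^γ |b_n|` for `n` large. -/
def Lsim (a b : ℕ → ℝ) : Prop :=
  ∃ c γ : ℝ, 0 < c ∧ ∀ᶠ n : ℕ in Filter.atTop, |a n| ≤ c * Real.log n ^ γ * |b n|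

end LPAM

open MeasureTheory

namespace LPAM

attribute [local instance] Classical.propDecidable

instance graphMeasurableSpace (n : ℕ) : MeasurableSpace (SimpleGraph (Fin n)) := ⊤

/-- `T` is a linear preferential attachment chain with seed `S` on the filtered probability
space `(Ω, F, μ)`: it is adapted, starts at `S`, and conditionally on `F_n`, the tree at time
`n+1` is obtained from the tree at time `n` by attaching a new vertex to a vertex `v` chosen
with probability proportional to its degree, i.e. `deg v/(2n−2)`. -/
def IsLPAMChain {n₀ : ℕ} (S : SimpleGraph (Fin n₀)) {Ω : Type*} {mΩ : MeasurableSpace Ω}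
    (μ : Measure Ω) (F : Filtration ℕ mΩ) (T : (n : ℕ) → Ω → SimpleGraph (Fin n)) : Prop :=
  (∀ n, @Measurable _ _ (F n) _ (T n)) ∧
  (∀ᵐ ω ∂μ, T n₀ ω = S) ∧
  (∀ n, n₀ ≤ n → ∀ A : Set Ω, MeasurableSet[F n] A → ∀ G' : SimpleGraph (Fin (n + 1)),
    μ (A ∩ {ω | T (n + 1) ω = G'}) =
      ∑ H : SimpleGraph (Fin n), ∑ v : Fin n,
        (if attach H v = G' then ENNReal.ofReal ((deg H v : ℝ) / (2 * (n : ℝ) - 2)) else 0) *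
          μ (A ∩ {ω | T n ω = H}))

theorem attach_adj_castSucc {m : ℕ} (G : SimpleGraph (Fin m)) (v a b : Fin m) :
    (attach G v).Adj a.castSucc b.castSucc ↔ G.Adj a b := by
  simp only [attach, SimpleGraph.fromRel_adj]
  constructor
  · rintro ⟨-, (⟨a', b', h1, h2, h⟩ | ⟨h, -⟩) | (⟨a', b', h1, h2, h⟩ | ⟨h, -⟩)⟩
    · rw [Fin.castSucc_inj] at h1 h2
      subst h1 h2
      exact h
    · exact absurd h (Fin.castSucc_lt_last a).ne
    · rw [Fin.castSucc_inj] at h1 h2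
      subst h1 h2
      exact h.symm
    · exact absurd h (Fin.castSucc_lt_last b).ne
  · intro h
    exact ⟨fun e => h.ne (Fin.castSucc_inj.1 e), Or.inl (Or.inl ⟨a, b, rfl, rfl, h⟩)⟩

theorem attach_adj_last_castSucc {m : ℕ} (G : SimpleGraph (Fin m)) (v a : Fin m) :
    (attach G v).Adj (Fin.last m) a.castSucc ↔ a = v := by
  simp only [attach, SimpleGraph.fromRel_adj]
  constructor
  · rintro ⟨-, (⟨a', b', h1, h2, h⟩ | ⟨-, h⟩) | (⟨a', b', h1, h2, h⟩ | ⟨h, -⟩)⟩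
    · exact absurd h1.symm (Fin.castSucc_lt_last a').ne
    · exact Fin.castSucc_inj.1 h
    · exact absurd h2.symm (Fin.castSucc_lt_last b').ne
    · exact absurd h (Fin.castSucc_lt_last a).ne
  · rintro rfl
    exact ⟨(Fin.castSucc_lt_last a).ne', Or.inl (Or.inr (by simp))⟩

theorem attach_adj_castSucc_last {m : ℕ} (G : SimpleGraph (Fin m)) (v a : Fin m) :
    (attach G v).Adj a.castSucc (Fin.last m) ↔ a = v := by
  rw [SimpleGraph.adj_comm, attach_adj_last_castSucc]

theorem deg_eq_sum {m : ℕ} (G : SimpleGraph (Fin m)) (v : Fin m) :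
    deg G v = ∑ w, if G.Adj v w then 1 else 0 := by
  rw [deg, Set.ncard_eq_toFinset_card', Finset.sum_boole, Nat.cast_id]
  congr 1
  ext w
  simp

theorem deg_eq_degree {m : ℕ} (G : SimpleGraph (Fin m)) (v : Fin m) :
    deg G v = G.degree v := by
  rw [deg, Set.ncard_eq_toFinset_card', SimpleGraph.degree, SimpleGraph.neighborFinset]

theorem deg_attach_castSucc {m : ℕ} (G : SimpleGraph (Fin m)) (v x : Fin m) :
    deg (attach G v) x.castSucc = deg G x + if x = v then 1 else 0 := by
  simp only [deg_eq_sum, Fin.sum_univ_castSucc, attach_adj_castSucc, attach_adj_castSucc_last]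

theorem deg_attach_last {m : ℕ} (G : SimpleGraph (Fin m)) (v : Fin m) :
    deg (attach G v) (Fin.last m) = 1 := by
  rw [deg_eq_sum, Fin.sum_univ_castSucc]
  simp only [attach_adj_last_castSucc]
  simp

/-- A graph on `Fin m` is a tree iff it is connected with degree sum `2(m-1)`. -/
theorem isTree_iff_connected_and_sum_deg {m : ℕ} (G : SimpleGraph (Fin m)) :
    G.IsTree ↔ G.Connected ∧ ∑ v, deg G v + 2 = 2 * m := by
  rw [SimpleGraph.isTree_iff_connected_and_card]
  simp only [deg_eq_degree, SimpleGraph.sum_degrees_eq_twice_card_edges, Nat.card_eq_fintype_card,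
    Fintype.card_fin, ← SimpleGraph.edgeFinset_card]
  refine and_congr_right fun _ => ?_
  omega

theorem sum_deg_attach {m : ℕ} (G : SimpleGraph (Fin m)) (v : Fin m) :
    ∑ x, deg (attach G v) x = ∑ x, deg G x + 2 := by
  simp [Fin.sum_univ_castSucc, deg_attach_castSucc, deg_attach_last, Finset.sum_add_distrib]

theorem isTree_attach {m : ℕ} {G : SimpleGraph (Fin m)} (hG : G.IsTree) (v : Fin m) :
    (attach G v).IsTree := by
  rw [isTree_iff_connected_and_sum_deg] at hG ⊢
  refine ⟨?_, by rw [sum_deg_attach]; omega⟩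
  have key : ∀ a : Fin (m + 1), (attach G v).Reachable v.castSucc a := by
    intro a
    induction a using Fin.lastCases with
    | last => exact ((attach_adj_castSucc_last G v v).2 rfl).reachable
    | cast a =>
      let f : G →g attach G v := ⟨Fin.castSucc, fun {a b} h => (attach_adj_castSucc G v a b).2 h⟩
      exact (hG.1 v a).map f
  exact ⟨fun a b => (key a).symm.trans (key b)⟩

theorem sum_deg_of_isTree {m : ℕ} {G : SimpleGraph (Fin m)} (hG : G.IsTree) :
    ∑ v, (deg G v : ℝ) = 2 * (m : ℝ) - 2 := by
  have h := ((isTree_iff_connected_and_sum_deg G).1 hG).2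
  have h' : ((∑ v, deg G v + 2 : ℕ) : ℝ) = ((2 * m : ℕ) : ℝ) := by rw [h]
  push_cast at h'
  linarith

theorem deg_pos_of_isTree {m : ℕ} {G : SimpleGraph (Fin m)} (hG : G.IsTree) (hm : 2 ≤ m)
    (v : Fin m) : 0 < deg G v := by
  have : Nontrivial (Fin m) := Fin.nontrivial_iff_two_le.2 hm
  rw [deg_eq_degree]
  exact hG.connected.preconnected.degree_pos_of_nontrivial v

/-- `φ` is an embedding (injective graph homomorphism). -/
def IsEmb {k m : ℕ} (G : SimpleGraph (Fin k)) (T : SimpleGraph (Fin m)) (φ : Fin k → Fin m) :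
    Prop :=
  Function.Injective φ ∧ ∀ a b, G.Adj a b → T.Adj (φ a) (φ b)

/-- The sum over embeddings `φ` of `G` into `T` of `∏ u, f u (deg (φ u))`. -/
def embSum {k m : ℕ} (G : SimpleGraph (Fin k)) (f : Fin k → ℕ → ℝ) (T : SimpleGraph (Fin m)) : ℝ :=
  ∑ φ : Fin k → Fin m, if IsEmb G T φ then ∏ u, f u (deg T (φ u)) else 0

/-- The falling factorial `[d]_j` as a real number. -/
def fall (j d : ℕ) : ℝ := (d.descFactorial j : ℝ)

theorem Dval_eq_embSum (τ : DecTree) {m : ℕ} (T : SimpleGraph (Fin m)) :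
    Dval τ T = embSum τ.graph (fun u => fall (τ.label u)) T := by
  unfold Dval embSum fall IsEmb
  refine Finset.sum_congr rfl fun φ _ => ?_
  congr 1

theorem embSum_update_linear {k m : ℕ} (G : SimpleGraph (Fin k)) (f : Fin k → ℕ → ℝ)
    (T : SimpleGraph (Fin m)) (u : Fin k) (a b : ℝ) (g h : ℕ → ℝ) :
    embSum G (Function.update f u (fun d => a * g d + b * h d)) T =
      a * embSum G (Function.update f u g) T + b * embSum G (Function.update f u h) T := by
  have key : ∀ (g : ℕ → ℝ) (φ : Fin k → Fin m),
      ∏ x, Function.update f u g x (deg T (φ x)) =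
        g (deg T (φ u)) * ∏ x ∈ univ.erase u, f x (deg T (φ x)) := by
    intro g φ
    rw [← Finset.mul_prod_erase univ _ (mem_univ u), Function.update_self]
    congr 1
    refine Finset.prod_congr rfl fun x hx => ?_
    rw [Function.update_of_ne (Finset.ne_of_mem_erase hx)]
  unfold embSum
  rw [Finset.mul_sum, Finset.mul_sum, ← Finset.sum_add_distrib]
  refine Finset.sum_congr rfl fun φ _ => ?_
  simp only [key]
  split_ifs <;> ring

/-- Splitting a sum over maps into `Fin (m+1)` supported on injective maps according to the
position, if any, of the preimage of the last element. -/
theorem sum_fin_succ_of_injective {k m : ℕ} (F : (Fin k → Fin (m + 1)) → ℝ)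
    (hF : ∀ φ, ¬ Function.Injective φ → F φ = 0) (v : Fin m) :
    ∑ φ, F φ = ∑ φ : Fin k → Fin m, F (fun x => (φ x).castSucc) +
      ∑ u, ∑ ψ : Fin k → Fin m,
        if ψ u = v then F (Function.update (fun x => (ψ x).castSucc) u (Fin.last m)) else 0 := by
  have h1 : ∀ φ, F φ = (if ∀ u, φ u ≠ Fin.last m then F φ else 0) +
      ∑ u, if φ u = Fin.last m then F φ else 0 := by
    intro φ
    by_cases hφ : Function.Injective φ
    · split_ifs with h
      · simp [h]
      · push Not at h
        obtain ⟨u, hu⟩ := h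
        rw [Finset.sum_eq_single u]
        · simp [hu]
        · intro x _ hx
          rw [if_neg]
          intro e
          exact hx (hφ (e.trans hu.symm))
        · simp
    · simp [hF φ hφ]
  rw [Finset.sum_congr rfl fun φ _ => h1 φ, Finset.sum_add_distrib, Finset.sum_comm]
  congr 1
  · symm
    refine Finset.sum_of_injOn (fun (φ : Fin k → Fin m) x => (φ x).castSucc) ?_ (by simp) ?_ ?_
    · intro φ _ φ' _ h
      funext x
      exact Fin.castSucc_injective m (congrFun h x)
    · intro φ _ hφ
      rw [if_neg]
      intro h
      refine hφ ⟨fun x => (φ x).castPred (h x), by simp, ?_⟩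
      funext x
      simp
    · intro φ _
      rw [if_pos]
      exact fun u => (Fin.castSucc_lt_last _).ne
  · refine Finset.sum_congr rfl fun u _ => ?_
    rw [← Finset.sum_filter (fun ψ : Fin k → Fin m => ψ u = v)]
    symm
    refine Finset.sum_of_injOn
      (fun (ψ : Fin k → Fin m) => Function.update (fun x => (ψ x).castSucc) u (Fin.last m))
      ?_ (by simp) ?_ ?_
    · intro ψ hψ ψ' hψ' h
      simp only [coe_filter, mem_univ, true_and, Set.mem_ofPred_eq] at hψ hψ'
      funext x
      by_cases hx : x = u
      · rw [hx, hψ, hψ']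
      · have := congrFun h x
        simpa [Function.update_of_ne hx] using this
    · intro φ _ hφ
      by_cases hu : φ u = Fin.last m
      · rw [if_pos hu]
        refine hF φ fun hinj => hφ ?_
        refine ⟨fun x => if hx : x = u then v else
          (φ x).castPred (fun e => hx (hinj (e.trans hu.symm))), by simp, ?_⟩
        funext x
        by_cases hx : x = u
        · subst hx
          simp [hu]
        · simp [hx]
      · rw [if_neg hu]
    · intro ψ _
      simp

theorem isEmb_castSucc {k m : ℕ} (G : SimpleGraph (Fin k)) (T : SimpleGraph (Fin m)) (v : Fin m)
    (φ : Fin k → Fin m) :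
    IsEmb G (attach T v) (fun x => (φ x).castSucc) ↔ IsEmb G T φ := by
  unfold IsEmb
  simp only [attach_adj_castSucc]
  refine and_congr_left fun _ => ⟨fun h a b hab => h (by simp [hab]), fun h a b hab => ?_⟩
  exact h (Fin.castSucc_injective m hab)

/-- The value of an embedding `φ` of `G` in the tree `attach T v`. -/
def attachVal {k m : ℕ} (G : SimpleGraph (Fin k)) (f : Fin k → ℕ → ℝ) (T : SimpleGraph (Fin m))
    (v : Fin m) (φ : Fin k → Fin (m + 1)) : ℝ :=
  if IsEmb G (attach T v) φ then ∏ u, f u (deg (attach T v) (φ u)) else 0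

theorem embSum_attach {k m : ℕ} (G : SimpleGraph (Fin k)) (f : Fin k → ℕ → ℝ)
    (T : SimpleGraph (Fin m)) (v : Fin m) :
    embSum G f (attach T v) =
      (∑ φ : Fin k → Fin m, if IsEmb G T φ then
        ∏ u, f u (deg T (φ u) + if φ u = v then 1 else 0) else 0) +
      ∑ u, ∑ ψ : Fin k → Fin m, if ψ u = v then
        attachVal G f T v (Function.update (fun x => (ψ x).castSucc) u (Fin.last m)) else 0 := by
  unfold embSum
  rw [sum_fin_succ_of_injective _ _ v]
  · simp only [isEmb_castSucc, deg_attach_castSucc]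
    rfl
  · intro φ hφ
    rw [if_neg]
    exact fun h => hφ h.1

theorem prod_add_indicator {k m : ℕ} (f : Fin k → ℕ → ℝ) (d : Fin m → ℕ)
    {φ : Fin k → Fin m} (hφ : Function.Injective φ) (v : Fin m) :
    ∏ u, f u (d (φ u) + if φ u = v then 1 else 0) = ∏ u, f u (d (φ u)) +
      ∑ u, if φ u = v then
        (f u (d (φ u) + 1) - f u (d (φ u))) * ∏ x ∈ univ.erase u, f x (d (φ x)) else 0 := by
  by_cases h : ∃ u, φ u = v
  · obtain ⟨u, rfl⟩ := h
    rw [Finset.sum_eq_single u, if_pos rfl, ← Finset.mul_prod_erase univ _ (mem_univ u), if_pos rfl,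
      ← Finset.mul_prod_erase univ (fun u => f u (d (φ u))) (mem_univ u)]
    · have : ∏ x ∈ univ.erase u, f x (d (φ x) + if φ x = φ u then 1 else 0) =
          ∏ x ∈ univ.erase u, f x (d (φ x)) := by
        refine Finset.prod_congr rfl fun x hx => ?_
        rw [if_neg (fun e => Finset.ne_of_mem_erase hx (hφ e)), add_zero]
      rw [this]
      ring
    · intro x _ hx
      rw [if_neg (fun e => hx (hφ e))]
    · simp
  · push Not at h
    simp [h]

theorem sum_deg_mul_embSum_old {k m : ℕ} (G : SimpleGraph (Fin k)) (f : Fin k → ℕ → ℝ)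
    (T : SimpleGraph (Fin m)) :
    ∑ v, (deg T v : ℝ) * (∑ φ : Fin k → Fin m, if IsEmb G T φ then
        ∏ u, f u (deg T (φ u) + if φ u = v then 1 else 0) else 0) =
      (∑ v, (deg T v : ℝ)) * embSum G f T +
        ∑ u, embSum G (Function.update f u (fun d => d * (f u (d + 1) - f u d))) T := by
  unfold embSum
  simp only [Finset.mul_sum]
  rw [Finset.sum_comm, Finset.sum_comm (s := univ (α := Fin k)), ← Finset.sum_add_distrib]
  refine Finset.sum_congr rfl fun φ _ => ?_
  by_cases hφ : IsEmb G T φ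
  · simp only [if_pos hφ, prod_add_indicator f (deg T) hφ.1, mul_add, Finset.sum_add_distrib,
      Finset.mul_sum, ← Finset.sum_mul]
    congr 1
    rw [Finset.sum_comm]
    refine Finset.sum_congr rfl fun u _ => ?_
    simp only [mul_ite, mul_zero, Finset.sum_ite_eq, mem_univ, if_true]
    rw [← Finset.mul_prod_erase univ _ (mem_univ u), Function.update_self, ← mul_assoc]
    congr 1
    refine Finset.prod_congr rfl fun x hx => ?_
    rw [Function.update_of_ne (Finset.ne_of_mem_erase hx)]
  · simp [hφ]

theorem isEmb_insertNth {K m : ℕ} (G : SimpleGraph (Fin (K + 1))) (T : SimpleGraph (Fin m))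
    (v : Fin m) (u : Fin (K + 1)) (φ : Fin K → Fin m) :
    IsEmb G (attach T v) (u.insertNth (α := fun _ => Fin (m + 1)) (Fin.last m)
        (fun x => (φ x).castSucc)) ↔
      IsEmb (G.comap u.succAbove) T φ ∧ ∀ q, G.Adj u (u.succAbove q) → φ q = v := by
  constructor
  · rintro ⟨h1, h2⟩
    refine ⟨⟨fun a b hab => ?_, fun a b hab => ?_⟩, fun q hq => ?_⟩
    · have := @h1 (u.succAbove a) (u.succAbove b) (by simp [hab])
      exact Fin.succAbove_right_injective this
    · have := h2 _ _ hab
      simpa [attach_adj_castSucc] using this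
    · have := h2 _ _ hq
      simpa [attach_adj_last_castSucc] using this
  · rintro ⟨⟨h1, h2⟩, h3⟩
    refine ⟨fun a b hab => ?_, fun a b hab => ?_⟩
    · induction a using u.succAboveCases with
      | x => induction b using u.succAboveCases with
        | x => rfl
        | p b => exact absurd hab.symm (by simp)
      | p a => induction b using u.succAboveCases with
        | x => exact absurd hab (by simp)
        | p b =>
          have h : φ a = φ b := by simpa using hab
          rw [h1 h]
    · induction a using u.succAboveCases with
      | x => induction b using u.succAboveCases with
        | x => exact absurd rfl hab.ne
        | p b => simpa [attach_adj_last_castSucc] using h3 _ hab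
      | p a => induction b using u.succAboveCases with
        | x => simpa [attach_adj_castSucc_last] using h3 _ hab.symm
        | p b => simpa [attach_adj_castSucc] using h2 a b hab

theorem sum_attachVal_update {K m : ℕ} (G : SimpleGraph (Fin (K + 1))) (f : Fin (K + 1) → ℕ → ℝ)
    (T : SimpleGraph (Fin m)) (v : Fin m) (u : Fin (K + 1)) :
    (∑ ψ : Fin (K + 1) → Fin m, if ψ u = v then
        attachVal G f T v (Function.update (fun x => (ψ x).castSucc) u (Fin.last m)) else 0) =
      ∑ φ : Fin K → Fin m,
        if IsEmb (G.comap u.succAbove) T φ ∧ ∀ q, G.Adj u (u.succAbove q) → φ q = v then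
          f u 1 * ∏ q, f (u.succAbove q) (deg T (φ q) + if φ q = v then 1 else 0) else 0 := by
  rw [← (Fin.insertNthEquiv (fun _ => Fin m) u).sum_comp, Fintype.sum_prod_type]
  simp only [Fin.insertNthEquiv_apply, Fin.insertNth_apply_same]
  rw [Finset.sum_eq_single v]
  · refine Finset.sum_congr rfl fun φ _ => ?_
    have e : Function.update (fun x => (u.insertNth (α := fun _ => Fin m) v φ x).castSucc) u
        (Fin.last m) = u.insertNth (α := fun _ => Fin (m + 1)) (Fin.last m)
          (fun x => (φ x).castSucc) := by
      funext x
      induction x using u.succAboveCases with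
      | x => simp
      | p x => simp
    rw [if_pos rfl, e, attachVal]
    refine if_congr (isEmb_insertNth G T v u φ) ?_ rfl
    rw [Fin.prod_univ_succAbove _ u]
    simp only [Fin.insertNth_apply_same, Fin.insertNth_apply_succAbove, deg_attach_last,
      deg_attach_castSucc]
  · intro x _ hx
    simp [hx]
  · simp

theorem sum_deg_mul_attachVal_leaf {K m : ℕ} (G : SimpleGraph (Fin (K + 1)))
    (f : Fin (K + 1) → ℕ → ℝ) (T : SimpleGraph (Fin m)) (u : Fin (K + 1)) (q₀ : Fin K)
    (hq : ∀ q, G.Adj u (u.succAbove q) ↔ q = q₀) :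
    ∑ v, (deg T v : ℝ) * (∑ φ : Fin K → Fin m,
        if IsEmb (G.comap u.succAbove) T φ ∧ ∀ q, G.Adj u (u.succAbove q) → φ q = v then
          f u 1 * ∏ q, f (u.succAbove q) (deg T (φ q) + if φ q = v then 1 else 0) else 0) =
      f u 1 * embSum (G.comap u.succAbove) (Function.update (fun q => f (u.succAbove q)) q₀
        (fun d => d * f (u.succAbove q₀) (d + 1))) T := by
  unfold embSum
  simp only [Finset.mul_sum, hq, forall_eq]
  rw [Finset.sum_comm]
  refine Finset.sum_congr rfl fun φ _ => ?_
  by_cases hφ : IsEmb (G.comap u.succAbove) T φ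
  · simp only [hφ, true_and, if_true]
    rw [Finset.sum_eq_single (φ q₀)]
    · rw [if_pos rfl, ← Finset.mul_prod_erase univ _ (mem_univ q₀),
        ← Finset.mul_prod_erase univ (fun x => Function.update (fun q => f (u.succAbove q)) q₀
          (fun d => d * f (u.succAbove q₀) (d + 1)) x (deg T (φ x))) (mem_univ q₀),
        Function.update_self, if_pos rfl]
      have : ∏ x ∈ univ.erase q₀, f (u.succAbove x)
          (deg T (φ x) + if φ x = φ q₀ then 1 else 0) =
          ∏ x ∈ univ.erase q₀, Function.update (fun q => f (u.succAbove q)) q₀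
            (fun d => d * f (u.succAbove q₀) (d + 1)) x (deg T (φ x)) := by
        refine Finset.prod_congr rfl fun x hx => ?_
        have hx' := Finset.ne_of_mem_erase hx
        rw [if_neg (fun e => hx' (hφ.1 e)), add_zero, Function.update_of_ne hx']
      rw [this]
      ring
    · intro x _ hx
      rw [if_neg (Ne.symm hx), mul_zero]
    · simp
  · simp [hφ]

/-- The observable `D_τ` as a function of a graph on any `Fin m`. -/
def dfun (τ : DecTree) : (m : ℕ) → SimpleGraph (Fin m) → ℝ := fun _ T => Dval τ T

/-- Linear combinations of the observables `D_σ` with `σ ≺ τ`. -/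
def lowerSpan (τ : DecTree) : Submodule ℝ ((m : ℕ) → SimpleGraph (Fin m) → ℝ) :=
  Submodule.span ℝ (dfun '' {σ | σ.lt τ})

/-- The growth rate of `D_τ`: the weight of `τ`, except for the trivial tree of weight one. -/
def DecTree.rate (τ : DecTree) : ℕ := max τ.weight 2

theorem dfun_mem_lowerSpan {σ τ : DecTree} (h : σ.lt τ) : dfun σ ∈ lowerSpan τ :=
  Submodule.subset_span ⟨σ, h, rfl⟩

/-- Replace the label of the vertex `u`. -/
def DecTree.setLabel (τ : DecTree) (u : Fin τ.n) (j : ℕ) (hj : 0 < j) : DecTree where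
  n := τ.n
  graph := τ.graph
  isTree := τ.isTree
  label := Function.update τ.label u j
  label_pos x := by
    by_cases h : x = u
    · subst h; simpa
    · simpa [Function.update_of_ne h] using τ.label_pos x

theorem DecTree.weight_setLabel (τ : DecTree) (u : Fin τ.n) (j : ℕ) (hj : 0 < j) :
    (τ.setLabel u j hj).weight + τ.label u = τ.weight + j := by
  unfold DecTree.weight DecTree.setLabel
  rw [← Finset.add_sum_erase univ τ.label (mem_univ u)]
  simp only
  rw [← Finset.add_sum_erase univ (Function.update τ.label u j) (mem_univ u), Function.update_self]
  have : ∑ x ∈ univ.erase u, Function.update τ.label u j x = ∑ x ∈ univ.erase u, τ.label x := by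
    refine Finset.sum_congr rfl fun x hx => ?_
    rw [Function.update_of_ne (Finset.ne_of_mem_erase hx)]
  omega

theorem Dval_setLabel (τ : DecTree) (u : Fin τ.n) (j : ℕ) (hj : 0 < j) {m : ℕ}
    (T : SimpleGraph (Fin m)) :
    Dval (τ.setLabel u j hj) T =
      embSum τ.graph (Function.update (fun x => fall (τ.label x)) u (fall j)) T := by
  rw [Dval_eq_embSum]
  congr 1
  funext (x : Fin τ.n)
  change fall (Function.update τ.label u j x) = _
  by_cases h : x = u
  · rw [h, Function.update_self, Function.update_self]
  · rw [Function.update_of_ne h, Function.update_of_ne h]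

theorem fall_succ_mul (j d : ℕ) : (d : ℝ) * fall j d = fall (j + 1) d + j * fall j d := by
  unfold fall
  rw [Nat.descFactorial_succ]
  rcases le_or_gt j d with h | h
  · push_cast [h]; ring
  · rw [Nat.descFactorial_of_lt h]; simp

theorem fall_add_one (j d : ℕ) : fall (j + 1) (d + 1) = fall (j + 1) d + (j + 1) * fall j d := by
  have h := fall_succ_mul j d
  have : fall (j + 1) (d + 1) = (d + 1) * fall j d := by
    unfold fall
    rw [Nat.succ_descFactorial_succ]
    push_cast; ring
  rw [this]
  linarith

theorem DecTree.n_le_weight (τ : DecTree) : τ.n ≤ τ.weight := by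
  unfold DecTree.weight
  calc τ.n = ∑ _u : Fin τ.n, 1 := by simp
    _ ≤ _ := Finset.sum_le_sum fun u _ => τ.label_pos u

theorem DecTree.n_pos (τ : DecTree) : 0 < τ.n := by
  obtain ⟨x⟩ := τ.isTree.connected.nonempty
  exact x.pos

theorem embSum_update_shift_mem (τ : DecTree) (u : Fin τ.n) :
    (fun (m : ℕ) (T : SimpleGraph (Fin m)) =>
      embSum τ.graph (Function.update (fun x => fall (τ.label x)) u
        (fun d => d * (fall (τ.label u) (d + 1) - fall (τ.label u) d))) T
          - τ.label u * Dval τ T) ∈ lowerSpan τ := by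
  obtain ⟨j, hj⟩ : ∃ j, τ.label u = j + 1 := ⟨τ.label u - 1, by have := τ.label_pos u; omega⟩
  have e1 : (fun d : ℕ => (d : ℝ) * (fall (τ.label u) (d + 1) - fall (τ.label u) d)) =
      fun d => ((j + 1 : ℕ) : ℝ) * fall (j + 1) d + ((j + 1) * j : ℕ) * fall j d := by
    funext d
    rw [hj, fall_add_one]
    have := fall_succ_mul j d
    push_cast
    linear_combination (j + 1 : ℝ) * this
  have e2 : Function.update (fun x => fall (τ.label x)) u (fall (j + 1)) =
      fun x => fall (τ.label x) := by
    rw [← hj]; exact Function.update_eq_self u _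
  simp only [e1, embSum_update_linear, e2, ← Dval_eq_embSum]
  rcases Nat.eq_zero_or_pos j with h0 | h0
  · subst h0
    simp only [hj]
    convert (lowerSpan τ).zero_mem using 1
    funext m T
    simp
  · simp only [← Dval_setLabel τ u j h0]
    have hlt : (τ.setLabel u j h0).lt τ := by
      left
      have := τ.weight_setLabel u j h0
      exact ⟨by omega, le_rfl⟩
    convert (lowerSpan τ).smul_mem (((j + 1) * j : ℕ) : ℝ) (dfun_mem_lowerSpan hlt) using 1
    funext m T
    simp [dfun, hj]

/-- A leaf of a tree: removing it leaves a tree. -/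
theorem isTree_comap_succAbove {K : ℕ} {G : SimpleGraph (Fin (K + 1))} (hG : G.IsTree)
    (u : Fin (K + 1)) (q₀ : Fin K) (hq : ∀ q, G.Adj u (u.succAbove q) ↔ q = q₀) :
    (G.comap u.succAbove).IsTree := by
  refine ⟨?_, hG.isAcyclic.of_comap ⟨_, Fin.succAbove_right_injective⟩⟩
  have hdeg : G.degree u = 1 := by
    rw [SimpleGraph.degree_eq_one_iff_existsUnique_adj]
    refine ⟨u.succAbove q₀, (hq q₀).2 rfl, fun y hy => ?_⟩
    induction y using u.succAboveCases with
    | x => exact absurd rfl hy.ne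
    | p y => rw [(hq y).1 hy]
  have h := hG.connected.induce_compl_singleton_of_degree_eq_one hdeg
  let e : Fin K → ({u}ᶜ : Set (Fin (K + 1))) := fun x => ⟨u.succAbove x, Fin.succAbove_ne u x⟩
  have he : Function.Bijective e := by
    refine ⟨fun a b hab => Fin.succAbove_right_injective (congrArg Subtype.val hab), ?_⟩
    rintro ⟨y, hy⟩
    obtain ⟨z, hz⟩ := Fin.exists_succAbove_eq hy
    exact ⟨z, Subtype.ext hz⟩
  let I : G.comap u.succAbove ≃g G.induce ({u}ᶜ : Set (Fin (K + 1))) :=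
    { toEquiv := Equiv.ofBijective e he
      map_rel_iff' := by intro a b; simp [e] }
  exact I.connected_iff.2 h

theorem leaf_mem_lowerSpan (K : ℕ) (G : SimpleGraph (Fin (K + 1))) (hG : G.IsTree)
    (ℓ : Fin (K + 1) → ℕ) (hℓ : ∀ u, 0 < ℓ u) (u : Fin (K + 1)) (hu : ℓ u = 1) (q₀ : Fin K)
    (hq : ∀ q, G.Adj u (u.succAbove q) ↔ q = q₀) :
    (fun (m : ℕ) (T : SimpleGraph (Fin m)) =>
      embSum (G.comap u.succAbove) (Function.update (fun q => fall (ℓ (u.succAbove q))) q₀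
        (fun d => d * fall (ℓ (u.succAbove q₀)) (d + 1))) T) ∈
      lowerSpan ⟨K + 1, G, hG, ℓ, hℓ⟩ := by
  let σ : DecTree := ⟨K, G.comap u.succAbove, isTree_comap_succAbove hG u q₀ hq,
    fun q => ℓ (u.succAbove q), fun q => hℓ _⟩
  have hw : σ.weight + 1 = (⟨K + 1, G, hG, ℓ, hℓ⟩ : DecTree).weight := by
    simp only [σ, DecTree.weight]
    rw [Fin.sum_univ_succAbove _ u, hu, add_comm]
  obtain ⟨j, hj⟩ : ∃ j, ℓ (u.succAbove q₀) = j + 1 :=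
    ⟨ℓ (u.succAbove q₀) - 1, by have := hℓ (u.succAbove q₀); omega⟩
  have hj' : σ.label q₀ = j + 1 := hj
  have e1 : (fun d : ℕ => (d : ℝ) * fall (ℓ (u.succAbove q₀)) (d + 1)) =
      fun d => (1 : ℝ) * fall (j + 2) d +
        (1 : ℝ) * ((2 * (j + 1) : ℕ) * fall (j + 1) d + ((j + 1) * j : ℕ) * fall j d) := by
    funext d
    rw [hj, fall_add_one]
    have h1 := fall_succ_mul j d
    have h2 := fall_succ_mul (j + 1) d
    push_cast at h2 ⊢
    linear_combination (j + 1 : ℝ) * h1 + h2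
  simp only [e1, embSum_update_linear]
  simp only [one_mul]
  have hmem : ∀ i (hi : 0 < i), i ≤ j + 2 →
      (fun (m : ℕ) (T : SimpleGraph (Fin m)) => embSum (G.comap u.succAbove)
        (Function.update (fun q => fall (ℓ (u.succAbove q))) q₀ (fall i)) T) ∈
        lowerSpan ⟨K + 1, G, hG, ℓ, hℓ⟩ := by
    intro i hi hij
    have hlt : (σ.setLabel q₀ i hi).lt ⟨K + 1, G, hG, ℓ, hℓ⟩ := by
      have h1 := σ.weight_setLabel q₀ i hi
      have h2 : (σ.setLabel q₀ i hi).n = K := rfl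
      unfold DecTree.lt
      simp only [h2]
      rw [← hw]
      omega
    convert dfun_mem_lowerSpan hlt using 1
    funext m T
    exact (Dval_setLabel σ q₀ i hi T).symm
  refine (lowerSpan _).add_mem (hmem (j + 2) (by omega) le_rfl) ((lowerSpan _).add_mem
    ((lowerSpan _).smul_mem _ (hmem (j + 1) (by omega) (by omega))) ?_)
  rcases Nat.eq_zero_or_pos j with h0 | h0
  · subst h0
    convert (lowerSpan _).zero_mem using 1
    funext m T
    simp
  · exact (lowerSpan _).smul_mem _ (hmem j h0 (by omega))

theorem fall_one_eq_zero {j : ℕ} (h : 2 ≤ j) : fall j 1 = 0 := by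
  unfold fall
  rw [Nat.descFactorial_of_lt (by omega)]
  simp

theorem exists_adj_of_isTree {K : ℕ} {G : SimpleGraph (Fin (K + 2))} (hG : G.IsTree)
    (u : Fin (K + 2)) : ∃ q, G.Adj u (u.succAbove q) := by
  have := deg_pos_of_isTree hG (by omega) u
  rw [deg_eq_degree] at this
  obtain ⟨y, hy⟩ := (SimpleGraph.degree_pos_iff_exists_adj G u).1 this
  obtain ⟨q, rfl⟩ := Fin.exists_succAbove_eq hy.ne'
  exact ⟨q, hy⟩

theorem new_vertex_mem_lowerSpan (K : ℕ) (G : SimpleGraph (Fin (K + 2))) (hG : G.IsTree)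
    (ℓ : Fin (K + 2) → ℕ) (hℓ : ∀ u, 0 < ℓ u) (u : Fin (K + 2)) :
    (fun (m : ℕ) (T : SimpleGraph (Fin m)) =>
      ∑ v, (deg T v : ℝ) * (∑ φ : Fin (K + 1) → Fin m,
        if IsEmb (G.comap u.succAbove) T φ ∧ ∀ q, G.Adj u (u.succAbove q) → φ q = v then
          fall (ℓ u) 1 * ∏ q, fall (ℓ (u.succAbove q)) (deg T (φ q) + if φ q = v then 1 else 0)
        else 0)) ∈
      lowerSpan ⟨K + 2, G, hG, ℓ, hℓ⟩ := by
  rcases (show ℓ u = 1 ∨ 2 ≤ ℓ u by have := hℓ u; omega) with hu | hu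
  · obtain ⟨q₀, hq₀⟩ := exists_adj_of_isTree hG u
    by_cases hq : ∀ q, G.Adj u (u.succAbove q) ↔ q = q₀
    · have h := leaf_mem_lowerSpan (K + 1) G hG ℓ hℓ u hu q₀ hq
      convert h using 1
      funext m T
      rw [sum_deg_mul_attachVal_leaf G (fun x => fall (ℓ x)) T u q₀ hq]
      simp [hu, fall]
    · push Not at hq
      obtain ⟨q₁, hq₁⟩ := hq
      have hq1 : G.Adj u (u.succAbove q₁) ∧ q₁ ≠ q₀ := by
        rcases hq₁ with h | h
        · exact h
        · exact absurd (h.2 ▸ hq₀) h.1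
      convert (lowerSpan _).zero_mem using 1
      funext m T
      refine Finset.sum_eq_zero fun v _ => mul_eq_zero_of_right _ (Finset.sum_eq_zero fun φ _ => ?_)
      rw [if_neg]
      rintro ⟨h1, h2⟩
      exact hq1.2 (h1.1 ((h2 _ hq1.1).trans (h2 _ hq₀).symm))
  · convert (lowerSpan _).zero_mem using 1
    funext m T
    simp [fall_one_eq_zero hu]

/-- One-step evolution of the observable `D_τ` under preferential attachment. -/
theorem sum_deg_mul_Dval_attach_mem (τ : DecTree) :
    (fun (m : ℕ) (T : SimpleGraph (Fin m)) =>
      ∑ v, (deg T v : ℝ) * Dval τ (attach T v) - (∑ v, (deg T v : ℝ) + τ.rate) * Dval τ T) ∈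
      lowerSpan τ := by
  have hshift := (lowerSpan τ).sum_mem fun u (_ : u ∈ univ) => embSum_update_shift_mem τ u
  have hw : (∑ u, (τ.label u : ℝ)) = τ.weight := by simp [DecTree.weight]
  obtain ⟨n, G, hG, ℓ, hℓ⟩ := τ
  match n with
  | 0 => exact absurd (DecTree.n_pos ⟨0, G, hG, ℓ, hℓ⟩) (lt_irrefl 0)
  | 1 =>
    convert hshift using 1
    funext m T
    simp only [Dval_eq_embSum, embSum_attach, mul_add, Finset.sum_add_distrib,
      sum_deg_mul_embSum_old, Finset.sum_apply, Finset.sum_sub_distrib, ← Finset.sum_mul, hw]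
    simp only [sum_attachVal_update]
    have hE : ∀ φ : Fin 0 → Fin m, IsEmb (G.comap (Fin.succAbove 0)) T φ := fun φ =>
      ⟨fun a => a.elim0, fun a => a.elim0⟩
    simp only [Finset.univ_unique, Fin.default_eq_zero, Finset.sum_singleton, hE, true_and,
      IsEmpty.forall_iff, if_true, Finset.univ_eq_empty, Finset.prod_empty, mul_one]
    have hE' : ∀ φ : Fin 1 → Fin m, IsEmb G T φ := fun φ =>
      ⟨Function.injective_of_subsingleton φ, fun a b hab =>
        absurd (Subsingleton.elim a b) hab.ne⟩
    have hwe : (⟨1, G, hG, ℓ, hℓ⟩ : DecTree).weight = ℓ 0 := by simp [DecTree.weight]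
    simp only [DecTree.rate, hwe]
    rcases (show ℓ 0 = 1 ∨ 2 ≤ ℓ 0 by have := hℓ 0; omega) with hu | hu
    · have : embSum G (fun u => fall (ℓ u)) T = ∑ v, (deg T v : ℝ) := by
        unfold embSum
        simp only [hE', if_true, Finset.univ_unique, Fin.default_eq_zero, Finset.prod_singleton,
          hu]
        rw [← (Equiv.funUnique (Fin 1) (Fin m)).symm.sum_comp]
        simp [fall]
      rw [this, hu]
      simp [fall]
      ring
    · rw [fall_one_eq_zero hu, max_eq_left hu]
      simp only [Finset.sum_const_zero, mul_zero]
      ring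
  | K + 2 =>
    have hnew := (lowerSpan _).sum_mem fun u (_ : u ∈ univ) =>
      new_vertex_mem_lowerSpan K G hG ℓ hℓ u
    convert (lowerSpan _).add_mem hshift hnew using 1
    funext m T
    have hr : (⟨K + 2, G, hG, ℓ, hℓ⟩ : DecTree).rate =
        (⟨K + 2, G, hG, ℓ, hℓ⟩ : DecTree).weight := by
      have := (⟨K + 2, G, hG, ℓ, hℓ⟩ : DecTree).n_le_weight
      simp only at this
      rw [DecTree.rate]
      omega
    simp only [Dval_eq_embSum, embSum_attach, mul_add, Finset.sum_add_distrib,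
      sum_deg_mul_embSum_old, Finset.sum_apply, Finset.sum_sub_distrib, ← Finset.sum_mul, hw,
      Pi.add_apply, sum_attachVal_update, hr]
    have hcomm : ∑ v, (deg T v : ℝ) * ∑ u, ∑ φ : Fin (K + 1) → Fin m,
        (if IsEmb (G.comap u.succAbove) T φ ∧ ∀ q, G.Adj u (u.succAbove q) → φ q = v then
          fall (ℓ u) 1 * ∏ q, fall (ℓ (u.succAbove q)) (deg T (φ q) + if φ q = v then 1 else 0)
        else 0) = ∑ u, ∑ v, (deg T v : ℝ) * ∑ φ : Fin (K + 1) → Fin m,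
        (if IsEmb (G.comap u.succAbove) T φ ∧ ∀ q, G.Adj u (u.succAbove q) → φ q = v then
          fall (ℓ u) 1 * ∏ q, fall (ℓ (u.succAbove q)) (deg T (φ q) + if φ q = v then 1 else 0)
        else 0) := by
      simp only [Finset.mul_sum]
      rw [Finset.sum_comm]
    rw [hcomm]
    ring

theorem finite_weight_le (W : ℕ) : {σ : DecTree | σ.weight ≤ W}.Finite := by
  let code : {σ : DecTree | σ.weight ≤ W} →
      Σ n : Fin (W + 1), SimpleGraph (Fin n) × (Fin n → Fin (W + 1)) := fun σ =>
    ⟨⟨σ.1.n, Nat.lt_succ_of_le (σ.1.n_le_weight.trans σ.2)⟩, σ.1.graph, fun u =>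
      ⟨σ.1.label u, Nat.lt_succ_of_le
        ((Finset.single_le_sum (fun _ _ => Nat.zero_le _) (mem_univ u)).trans σ.2)⟩⟩
  have hcode : Function.Injective code := by
    rintro ⟨⟨n, G, hG, ℓ, hℓ⟩, h⟩ ⟨⟨n', G', hG', ℓ', hℓ'⟩, h'⟩ e
    simp only [code, Sigma.mk.injEq, Fin.mk.injEq] at e
    obtain ⟨rfl, e⟩ := e
    simp only [heq_eq_eq, Prod.mk.injEq] at e
    obtain ⟨rfl, e⟩ := e
    have : ℓ = ℓ' := by
      funext u
      have := congrFun e u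
      simpa using this
    subst this
    rfl
  exact Set.finite_coe_iff.1 (Finite.of_injective code hcode)

/-- The decorated trees of weight at most `W`. -/
def treesUpTo (W : ℕ) : Finset DecTree := (finite_weight_le W).toFinset

theorem mem_treesUpTo {W : ℕ} {σ : DecTree} : σ ∈ treesUpTo W ↔ σ.weight ≤ W := by
  simp [treesUpTo]

theorem fall_nonneg (j d : ℕ) : 0 ≤ fall j d := Nat.cast_nonneg _

theorem fall_mono (j : ℕ) {a b : ℕ} (h : a ≤ b) : fall j a ≤ fall j b :=
  Nat.cast_le.2 (Nat.descFactorial_le j h)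

theorem fall_le_pow (j d : ℕ) : fall j d ≤ (d : ℝ) ^ j := by
  unfold fall
  exact_mod_cast Nat.descFactorial_le_pow d j

theorem embSum_nonneg {k m : ℕ} (G : SimpleGraph (Fin k)) {f : Fin k → ℕ → ℝ}
    (hf : ∀ u d, 0 ≤ f u d) (T : SimpleGraph (Fin m)) : 0 ≤ embSum G f T :=
  Finset.sum_nonneg fun φ _ => by
    split_ifs
    · exact Finset.prod_nonneg fun u _ => hf _ _
    · exact le_rfl

theorem Dval_nonneg (τ : DecTree) {m : ℕ} (T : SimpleGraph (Fin m)) : 0 ≤ Dval τ T := by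
  rw [Dval_eq_embSum]
  exact embSum_nonneg _ (fun u d => fall_nonneg _ _) T

/-- The part of `∑ σ, D_σ(T)` (over trees of weight at most `W`) of embeddings with image `A`. -/
def imageSum (W : ℕ) {m : ℕ} (T : SimpleGraph (Fin m)) (A : Finset (Fin m)) : ℝ :=
  ∑ σ ∈ treesUpTo W, ∑ φ : Fin σ.n → Fin m,
    if IsEmb σ.graph T φ ∧ univ.image φ = A then ∏ u, fall (σ.label u) (deg T (φ u)) else 0

/-- A label at most `L` for which the falling factorial of `d` is comparable with `d ^ L`. -/
def reducedLabel (L d : ℕ) : ℕ := if 2 * L ≤ d then L else 1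

theorem pow_le_mul_fall_reducedLabel {L d : ℕ} (hL : 0 < L) (hd : 0 < d) :
    (d : ℝ) ^ L ≤ (2 * L : ℝ) ^ L * fall (reducedLabel L d) d := by
  unfold reducedLabel fall
  split_ifs with h
  · have h1 := Nat.pow_sub_le_descFactorial d L
    have h2 : d ≤ 2 * (d + 1 - L) := by omega
    have h3 : d ^ L ≤ (2 * L) ^ L * d.descFactorial L := by
      calc d ^ L ≤ (2 * (d + 1 - L)) ^ L := Nat.pow_le_pow_left h2 L
        _ = 2 ^ L * (d + 1 - L) ^ L := mul_pow _ _ _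
        _ ≤ (2 * L) ^ L * d.descFactorial L :=
          Nat.mul_le_mul (Nat.pow_le_pow_left (by omega) L) h1
    exact_mod_cast h3
  · have h3 : d ^ L ≤ (2 * L) ^ L * d.descFactorial 1 := by
      rw [Nat.descFactorial_one]
      calc d ^ L ≤ (2 * L) ^ L := Nat.pow_le_pow_left (by omega) L
        _ ≤ (2 * L) ^ L * d := Nat.le_mul_of_pos_right _ hd
    exact_mod_cast h3

theorem prod_pow_deg_le_imageSum {m : ℕ} {T : SimpleGraph (Fin m)} (hT : T.IsTree) (hm : 2 ≤ m)
    {W : ℕ} (A : Finset (Fin m)) (hA : (T.induce (A : Set (Fin m))).Connected)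
    (L : Fin m → ℕ) (hL : ∀ a ∈ A, 0 < L a) (hW : ∑ a ∈ A, L a ≤ W) :
    ∏ a ∈ A, (deg T a : ℝ) ^ L a ≤ (2 * W : ℝ) ^ W * imageSum W T A := by
  have hpos := deg_pos_of_isTree hT hm
  let e : Fin #A ≃ A := A.equivFin.symm
  let I : T.comap (fun u => (e u : Fin m)) ≃g T.induce (A : Set (Fin m)) :=
    { toEquiv := e
      map_rel_iff' := by intro a b; simp }
  let σ : DecTree :=
    { n := #A
      graph := T.comap (fun u => (e u : Fin m))
      isTree := ⟨I.connected_iff.2 hA, hT.isAcyclic.of_comap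
        ⟨_, Subtype.val_injective.comp e.injective⟩⟩
      label := fun u => reducedLabel (L (e u)) (deg T (e u))
      label_pos := by
        intro u
        unfold reducedLabel
        split_ifs
        · exact hL _ (e u).2
        · exact one_pos }
  have hred : ∀ a ∈ A, reducedLabel (L a) (deg T a) ≤ L a := by
    intro a ha
    unfold reducedLabel
    split_ifs
    · exact le_rfl
    · exact hL a ha
  have hσ : σ ∈ treesUpTo W := by
    rw [mem_treesUpTo]
    refine le_trans ?_ hW
    calc σ.weight = ∑ a : A, reducedLabel (L a) (deg T a) :=
          e.sum_comp fun a : A => reducedLabel (L a) (deg T a)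
      _ = ∑ a ∈ A, reducedLabel (L a) (deg T a) :=
          Finset.sum_coe_sort A fun a => reducedLabel (L a) (deg T a)
      _ ≤ _ := Finset.sum_le_sum hred
  let φ : Fin σ.n → Fin m := fun u => e u
  have hφ : IsEmb σ.graph T φ ∧ univ.image φ = A := by
    refine ⟨⟨Subtype.val_injective.comp e.injective, fun a b hab => hab⟩, ?_⟩
    ext a
    simp only [mem_image, mem_univ, true_and]
    refine ⟨?_, fun ha => ⟨e.symm ⟨a, ha⟩, by simp [φ]⟩⟩
    rintro ⟨u, rfl⟩
    exact (e u).2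
  have hval : ∏ u, fall (σ.label u) (deg T (φ u)) =
      ∏ a ∈ A, fall (reducedLabel (L a) (deg T a)) (deg T a) := by
    rw [← Finset.prod_coe_sort A fun a => fall (reducedLabel (L a) (deg T a)) (deg T a)]
    exact e.prod_comp fun a : A => fall (reducedLabel (L a) (deg T a)) (deg T a)
  have hterm : ∀ (σ : DecTree) (φ : Fin σ.n → Fin m), 0 ≤
      if IsEmb σ.graph T φ ∧ univ.image φ = A then ∏ u, fall (σ.label u) (deg T (φ u)) else 0 := by
    intro σ φ
    split_ifs
    · exact Finset.prod_nonneg fun u _ => fall_nonneg _ _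
    · exact le_rfl
  have hle : ∏ a ∈ A, fall (reducedLabel (L a) (deg T a)) (deg T a) ≤ imageSum W T A := by
    rw [← hval, imageSum]
    refine le_trans ?_ (Finset.single_le_sum (fun σ _ => Finset.sum_nonneg fun φ _ => hterm σ φ) hσ)
    refine le_trans ?_ (Finset.single_le_sum (fun φ _ => hterm σ φ) (mem_univ φ))
    rw [if_pos hφ]
  obtain ⟨⟨a₀, ha₀⟩⟩ := hA.nonempty
  have hW1 : 1 ≤ W := by
    have h1 := hL a₀ ha₀
    have h2 := Finset.single_le_sum (f := L) (fun _ _ => Nat.zero_le _) ha₀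
    omega
  have hW1' : (1 : ℝ) ≤ W := by exact_mod_cast hW1
  calc ∏ a ∈ A, (deg T a : ℝ) ^ L a
      ≤ ∏ a ∈ A, ((2 * W : ℝ) ^ L a * fall (reducedLabel (L a) (deg T a)) (deg T a)) := by
        refine Finset.prod_le_prod (fun a _ => by positivity) fun a ha => ?_
        refine (pow_le_mul_fall_reducedLabel (hL a ha) (hpos a)).trans ?_
        refine mul_le_mul_of_nonneg_right ?_ (fall_nonneg _ _)
        refine pow_le_pow_left₀ (by positivity) ?_ _
        have : L a ≤ W :=
          (Finset.single_le_sum (f := L) (fun _ _ => Nat.zero_le _) ha).trans hW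
        have : (L a : ℝ) ≤ W := by exact_mod_cast this
        linarith
    _ = (2 * W : ℝ) ^ (∑ a ∈ A, L a) *
          ∏ a ∈ A, fall (reducedLabel (L a) (deg T a)) (deg T a) := by
        rw [Finset.prod_mul_distrib, Finset.prod_pow_eq_pow_sum]
    _ ≤ (2 * W : ℝ) ^ W * imageSum W T A := by
        refine mul_le_mul (pow_le_pow_right₀ (by linarith) hW) hle ?_ (by positivity)
        exact Finset.prod_nonneg fun u _ => fall_nonneg _ _

/-- `ψ` maps adjacent vertices to equal or adjacent vertices. -/
def IsWeakHom {k m : ℕ} (G : SimpleGraph (Fin k)) (T : SimpleGraph (Fin m)) (ψ : Fin k → Fin m) :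
    Prop :=
  ∀ a b, G.Adj a b → ψ a = ψ b ∨ T.Adj (ψ a) (ψ b)

theorem IsWeakHom.reachable {k m : ℕ} {G : SimpleGraph (Fin k)} {T : SimpleGraph (Fin m)}
    {ψ : Fin k → Fin m} (hψ : IsWeakHom G T ψ) {A : Set (Fin m)} (hA : ∀ i, ψ i ∈ A)
    {a b : Fin k} (h : G.Reachable a b) :
    (T.induce A).Reachable ⟨ψ a, hA a⟩ ⟨ψ b, hA b⟩ := by
  obtain ⟨p⟩ := h
  induction p with
  | nil => exact SimpleGraph.Reachable.refl _
  | cons hadj _ ih =>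
    refine SimpleGraph.Reachable.trans ?_ ih
    rcases hψ _ _ hadj with h | h
    · have : ∀ x y : A, x = y → (T.induce A).Reachable x y := by
        rintro x _ rfl
        exact SimpleGraph.Reachable.refl _
      exact this _ _ (Subtype.ext h)
    · exact SimpleGraph.Adj.reachable (G := T.induce A) h

/-- The total label carried to `a` by `ψ`. -/
def pushLabel {k m : ℕ} (ℓ : Fin k → ℕ) (ψ : Fin k → Fin m) (a : Fin m) : ℕ :=
  ∑ i, if ψ i = a then ℓ i else 0

theorem sum_pushLabel {k m : ℕ} (ℓ : Fin k → ℕ) (ψ : Fin k → Fin m) :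
    ∑ a, pushLabel ℓ ψ a = ∑ i, ℓ i := by
  unfold pushLabel
  rw [Finset.sum_comm]
  simp

theorem prod_pow_pushLabel {k m : ℕ} (ℓ : Fin k → ℕ) (ψ : Fin k → Fin m) (x : Fin m → ℝ) :
    ∏ a, x a ^ pushLabel ℓ ψ a = ∏ i, x (ψ i) ^ ℓ i := by
  unfold pushLabel
  simp only [← Finset.prod_pow_eq_pow_sum]
  rw [Finset.prod_comm]
  refine Finset.prod_congr rfl fun i _ => ?_
  rw [Finset.prod_eq_single (ψ i)]
  · simp
  · intro b _ hb
    rw [if_neg (Ne.symm hb), pow_zero]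
  · simp

theorem label_le_pushLabel {k m : ℕ} (ℓ : Fin k → ℕ) (ψ : Fin k → Fin m) (i : Fin k) :
    ℓ i ≤ pushLabel ℓ ψ (ψ i) := by
  unfold pushLabel
  refine le_trans ?_ (Finset.single_le_sum (fun _ _ => Nat.zero_le _) (mem_univ i))
  simp

theorem pushLabel_eq_zero {k m : ℕ} (ℓ : Fin k → ℕ) (ψ : Fin k → Fin m) {a : Fin m}
    (h : ∀ i, ψ i ≠ a) : pushLabel ℓ ψ a = 0 := by
  simp [pushLabel, h]

theorem prod_pow_mul_prod_pow_div_le (τ : DecTree) {m : ℕ} {T : SimpleGraph (Fin m)}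
    (hT : T.IsTree) (hm : 2 ≤ m) {ψ₁ ψ₂ : Fin τ.n → Fin m} (h₁ : IsWeakHom τ.graph T ψ₁)
    (h₂ : IsWeakHom τ.graph T ψ₂) {v : Fin m} {u₁ u₂ : Fin τ.n} (hu₁ : ψ₁ u₁ = v)
    (hu₂ : ψ₂ u₂ = v) :
    (∏ i, (deg T (ψ₁ i) : ℝ) ^ τ.label i) * (∏ i, (deg T (ψ₂ i) : ℝ) ^ τ.label i) / deg T v ≤
      (2 * (2 * τ.weight - 1 : ℕ) : ℝ) ^ (2 * τ.weight - 1) *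
        imageSum (2 * τ.weight - 1) T (univ.image ψ₁ ∪ univ.image ψ₂) := by
  have hpos := deg_pos_of_isTree hT hm
  have hvpos : (0 : ℝ) < deg T v := by exact_mod_cast hpos v
  set A := univ.image ψ₁ ∪ univ.image ψ₂ with hAdef
  have hA₁ : ∀ i, ψ₁ i ∈ (A : Set (Fin m)) := fun i => by simp [A]
  have hA₂ : ∀ i, ψ₂ i ∈ (A : Set (Fin m)) := fun i => by simp [A]
  have hconn : (T.induce (A : Set (Fin m))).Connected := by
    rw [SimpleGraph.connected_iff_exists_forall_reachable]
    refine ⟨⟨v, hu₁ ▸ hA₁ u₁⟩, ?_⟩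
    rintro ⟨a, ha⟩
    have ha' : (∃ i, ψ₁ i = a) ∨ ∃ i, ψ₂ i = a := by simpa [A] using ha
    rcases ha' with ⟨i, rfl⟩ | ⟨i, rfl⟩
    · subst hu₁
      exact h₁.reachable hA₁ (τ.isTree.connected u₁ i)
    · subst hu₂
      exact h₂.reachable hA₂ (τ.isTree.connected u₂ i)
  have hv : 2 ≤ pushLabel τ.label ψ₁ v + pushLabel τ.label ψ₂ v := by
    have a1 := label_le_pushLabel τ.label ψ₁ u₁
    have a2 := label_le_pushLabel τ.label ψ₂ u₂
    rw [hu₁] at a1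
    rw [hu₂] at a2
    have := τ.label_pos u₁
    have := τ.label_pos u₂
    omega
  let L : Fin m → ℕ := fun a =>
    pushLabel τ.label ψ₁ a + pushLabel τ.label ψ₂ a - if a = v then 1 else 0
  have hL' : ∀ a, L a + (if a = v then 1 else 0) =
      pushLabel τ.label ψ₁ a + pushLabel τ.label ψ₂ a := by
    intro a
    simp only [L]
    split_ifs with h
    · subst h; omega
    · rfl
  have hL : ∀ a ∈ A, 0 < L a := by
    intro a ha
    have ha' : (∃ i, ψ₁ i = a) ∨ ∃ i, ψ₂ i = a := by simpa [A] using ha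
    by_cases hav : a = v
    · subst hav
      simp only [L, if_true]
      omega
    · simp only [L, if_neg hav]
      rcases ha' with ⟨i, rfl⟩ | ⟨i, rfl⟩
      · have := label_le_pushLabel τ.label ψ₁ i
        have := τ.label_pos i
        omega
      · have := label_le_pushLabel τ.label ψ₂ i
        have := τ.label_pos i
        omega
  have hsum : ∑ a, L a = 2 * τ.weight - 1 := by
    have : ∑ a, (L a + if a = v then 1 else 0) = 2 * τ.weight := by
      simp only [hL', Finset.sum_add_distrib, sum_pushLabel]
      rw [DecTree.weight]; omega
    rw [Finset.sum_add_distrib] at this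
    simp only [Finset.sum_ite_eq', mem_univ, if_true] at this
    omega
  have hLout : ∀ a, a ∉ A → L a = 0 := by
    intro a ha
    have e1 := pushLabel_eq_zero τ.label ψ₁ (a := a) fun i h => ha (h ▸ hA₁ i)
    have e2 := pushLabel_eq_zero τ.label ψ₂ (a := a) fun i h => ha (h ▸ hA₂ i)
    simp only [L, e1, e2]
    omega
  refine le_trans (le_of_eq ?_) (prod_pow_deg_le_imageSum hT hm A hconn L hL
    ((Finset.sum_le_univ_sum_of_nonneg fun _ => Nat.zero_le _).trans hsum.le))
  rw [Finset.prod_subset (subset_univ A) fun a _ ha => by rw [hLout a ha, pow_zero],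
    div_eq_iff hvpos.ne', ← prod_pow_pushLabel τ.label ψ₁ fun a => (deg T a : ℝ),
    ← prod_pow_pushLabel τ.label ψ₂ fun a => (deg T a : ℝ), ← Finset.prod_mul_distrib]
  simp only [← pow_add, ← hL']
  simp only [pow_add, Finset.prod_mul_distrib]
  congr 1
  rw [Finset.prod_eq_single v]
  · simp
  · intro b _ hb
    rw [if_neg hb, pow_zero]
  · simp

theorem card_image_subset_le {k m : ℕ} (B : Finset (Fin m)) :
    #{ψ : Fin k → Fin m | univ.image ψ ⊆ B} ≤ #B ^ k := by
  have : #(Fintype.piFinset fun _ : Fin k => B) = #B ^ k := by simp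
  rw [← this]
  refine Finset.card_le_card fun ψ hψ => ?_
  simp only [mem_filter, mem_univ, true_and] at hψ
  rw [Fintype.mem_piFinset]
  exact fun i => hψ (mem_image_of_mem _ (mem_univ i))

theorem sum_imageSum_le (k W : ℕ) {m : ℕ} (T : SimpleGraph (Fin m)) :
    ∑ ψ₁ : Fin k → Fin m, ∑ ψ₂ : Fin k → Fin m, imageSum W T (univ.image ψ₁ ∪ univ.image ψ₂) ≤
      ((W : ℝ) ^ k * (W : ℝ) ^ k) * ∑ σ ∈ treesUpTo W, Dval σ T := by
  have hswap : ∑ ψ₁ : Fin k → Fin m, ∑ ψ₂ : Fin k → Fin m,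
      imageSum W T (univ.image ψ₁ ∪ univ.image ψ₂) =
      ∑ σ ∈ treesUpTo W, ∑ φ : Fin σ.n → Fin m, ∑ ψ₁ : Fin k → Fin m, ∑ ψ₂ : Fin k → Fin m,
        if IsEmb σ.graph T φ ∧ univ.image φ = univ.image ψ₁ ∪ univ.image ψ₂ then
          ∏ u, fall (σ.label u) (deg T (φ u)) else 0 := by
    unfold imageSum
    simp only [Finset.sum_comm (s := univ (α := Fin k → Fin m)) (t := treesUpTo W)]
    refine Finset.sum_congr rfl fun σ _ => ?_
    simp only [Finset.sum_comm (s := univ (α := Fin k → Fin m)) (t := univ (α := Fin σ.n → Fin m))]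
  rw [hswap, Finset.mul_sum]
  refine Finset.sum_le_sum fun σ hσ => ?_
  rw [Dval_eq_embSum, embSum, Finset.mul_sum]
  refine Finset.sum_le_sum fun φ _ => ?_
  by_cases hφ : IsEmb σ.graph T φ
  · simp only [hφ, true_and, if_true]
    set P := ∏ u, fall (σ.label u) (deg T (φ u)) with hP
    have hP0 : 0 ≤ P := Finset.prod_nonneg fun u _ => fall_nonneg _ _
    have hcard : (#{ψ : Fin k → Fin m | univ.image ψ ⊆ univ.image φ} : ℝ) ≤ (W : ℝ) ^ k := by
      have h1 := card_image_subset_le (k := k) (univ.image φ)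
      have h2 : #(univ.image φ) ≤ W := by
        refine Finset.card_image_le.trans ?_
        rw [Finset.card_univ, Fintype.card_fin]
        exact σ.n_le_weight.trans (mem_treesUpTo.1 hσ)
      exact_mod_cast h1.trans (Nat.pow_le_pow_left h2 k)
    calc ∑ ψ₁ : Fin k → Fin m, ∑ ψ₂ : Fin k → Fin m,
          (if univ.image φ = univ.image ψ₁ ∪ univ.image ψ₂ then P else 0)
        ≤ ∑ ψ₁ : Fin k → Fin m, ∑ ψ₂ : Fin k → Fin m,
          (if univ.image ψ₁ ⊆ univ.image φ then 1 else 0) *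
            ((if univ.image ψ₂ ⊆ univ.image φ then 1 else 0) * P) := by
          refine Finset.sum_le_sum fun ψ₁ _ => Finset.sum_le_sum fun ψ₂ _ => ?_
          by_cases h : univ.image φ = univ.image ψ₁ ∪ univ.image ψ₂
          · rw [if_pos h, if_pos (h ▸ subset_union_left), if_pos (h ▸ subset_union_right)]
            simp
          · rw [if_neg h]
            positivity
      _ = (#{ψ : Fin k → Fin m | univ.image ψ ⊆ univ.image φ} : ℝ) *
            ((#{ψ : Fin k → Fin m | univ.image ψ ⊆ univ.image φ} : ℝ) * P) := by
          simp only [← Finset.mul_sum, ← Finset.sum_mul, Finset.sum_boole]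
      _ ≤ _ := by
          rw [← mul_assoc]
          gcongr
  · simp [hφ]

theorem fall_diff_nonneg (j d : ℕ) : 0 ≤ fall j (d + 1) - fall j d :=
  sub_nonneg.2 (fall_mono j (Nat.le_succ d))

theorem fall_diff_mul_le {j : ℕ} (hj : 0 < j) (d : ℕ) :
    (fall j (d + 1) - fall j d) * d ≤ j * (d : ℝ) ^ j := by
  obtain ⟨i, rfl⟩ : ∃ i, j = i + 1 := ⟨j - 1, by omega⟩
  rw [fall_add_one, pow_succ]
  have h := fall_le_pow i d
  have : (0 : ℝ) ≤ d := Nat.cast_nonneg d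
  push_cast
  have h2 : fall i d * d ≤ (d : ℝ) ^ i * d := mul_le_mul_of_nonneg_right h this
  nlinarith [fall_nonneg i d]

theorem attachVal_nonneg {k m : ℕ} (G : SimpleGraph (Fin k)) {f : Fin k → ℕ → ℝ}
    (hf : ∀ u d, 0 ≤ f u d) (T : SimpleGraph (Fin m)) (v : Fin m) (φ : Fin k → Fin (m + 1)) :
    0 ≤ attachVal G f T v φ := by
  unfold attachVal
  split_ifs
  · exact Finset.prod_nonneg fun u _ => hf _ _
  · exact le_rfl

theorem IsEmb.isWeakHom {k m : ℕ} {G : SimpleGraph (Fin k)} {T : SimpleGraph (Fin m)}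
    {φ : Fin k → Fin m} (h : IsEmb G T φ) : IsWeakHom G T φ :=
  fun a b hab => Or.inr (h.2 a b hab)

theorem isWeakHom_of_isEmb_update {k m : ℕ} {G : SimpleGraph (Fin k)} {T : SimpleGraph (Fin m)}
    {v : Fin m} {u : Fin k} {ψ : Fin k → Fin m} (hu : ψ u = v)
    (h : IsEmb G (attach T v) (Function.update (fun x => (ψ x).castSucc) u (Fin.last m))) :
    IsWeakHom G T ψ := by
  intro a b hab
  have h2 := h.2 a b hab
  by_cases ha : a = u
  · subst ha
    rw [Function.update_self, Function.update_of_ne hab.ne', attach_adj_last_castSucc] at h2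
    exact Or.inl (hu.trans h2.symm)
  · rw [Function.update_of_ne ha] at h2
    by_cases hb : b = u
    · subst hb
      rw [Function.update_self, attach_adj_castSucc_last] at h2
      exact Or.inl (h2.trans hu.symm)
    · rw [Function.update_of_ne hb, attach_adj_castSucc] at h2
      exact Or.inr h2

/-- The weak homomorphisms weighted by powers of degrees. -/
def powVal (τ : DecTree) {m : ℕ} (T : SimpleGraph (Fin m)) (ψ : Fin τ.n → Fin m) : ℝ :=
  ∏ i, (deg T (ψ i) : ℝ) ^ τ.label i

theorem powVal_nonneg (τ : DecTree) {m : ℕ} (T : SimpleGraph (Fin m)) (ψ : Fin τ.n → Fin m) :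
    0 ≤ powVal τ T ψ := Finset.prod_nonneg fun _ _ => by positivity

theorem attachVal_mul_le (τ : DecTree) {m : ℕ} {T : SimpleGraph (Fin m)}
    (hpos : ∀ x, 0 < deg T x) (v : Fin m) (u : Fin τ.n) (ψ : Fin τ.n → Fin m) (hu : ψ u = v) :
    attachVal τ.graph (fun x => fall (τ.label x)) T v
        (Function.update (fun x => (ψ x).castSucc) u (Fin.last m)) * deg T v ≤
      2 ^ τ.weight * powVal τ T ψ := by
  have h0 : 0 ≤ (2 : ℝ) ^ τ.weight * powVal τ T ψ :=
    mul_nonneg (by positivity) (powVal_nonneg τ T ψ)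
  unfold attachVal
  split_ifs
  swap
  · simpa using h0
  rw [← Finset.mul_prod_erase univ _ (mem_univ u), Function.update_self, deg_attach_last]
  beta_reduce
  rcases (show τ.label u = 1 ∨ 2 ≤ τ.label u by have := τ.label_pos u; omega) with hl | hl
  · have h1 : fall (τ.label u) 1 = 1 := by rw [hl]; simp [fall]
    have h2 : ∏ x ∈ univ.erase u, fall (τ.label x) (deg (attach T v)
        (Function.update (fun x => (ψ x).castSucc) u (Fin.last m) x)) ≤
        ∏ x ∈ univ.erase u, (2 ^ τ.label x * (deg T (ψ x) : ℝ) ^ τ.label x) := by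
      refine Finset.prod_le_prod (fun _ _ => fall_nonneg _ _) fun x hx => ?_
      rw [Function.update_of_ne (Finset.ne_of_mem_erase hx), deg_attach_castSucc]
      refine (fall_le_pow _ _).trans ?_
      rw [← mul_pow]
      refine pow_le_pow_left₀ (by positivity) ?_ _
      have := hpos (ψ x)
      have h3 : (deg T (ψ x) + if ψ x = v then 1 else 0) ≤ 2 * deg T (ψ x) := by
        split_ifs <;> omega
      exact_mod_cast h3
    rw [Finset.prod_mul_distrib, Finset.prod_pow_eq_pow_sum] at h2
    have h3 : ∑ x ∈ univ.erase u, τ.label x ≤ τ.weight := by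
      exact Finset.sum_le_sum_of_subset (erase_subset _ _)
    have h4 : powVal τ T ψ =
        deg T v * ∏ x ∈ univ.erase u, (deg T (ψ x) : ℝ) ^ τ.label x := by
      rw [powVal, ← Finset.mul_prod_erase univ _ (mem_univ u), hl, hu, pow_one]
    have h5 : (2 : ℝ) ^ (∑ x ∈ univ.erase u, τ.label x) ≤ 2 ^ τ.weight :=
      pow_le_pow_right₀ (by norm_num) h3
    have h6 : 0 ≤ ∏ x ∈ univ.erase u, (deg T (ψ x) : ℝ) ^ τ.label x :=
      Finset.prod_nonneg fun _ _ => by positivity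
    rw [h1, one_mul, h4, mul_comm, mul_left_comm]
    exact mul_le_mul_of_nonneg_left (h2.trans (mul_le_mul_of_nonneg_right h5 h6))
      (Nat.cast_nonneg _)
  · rw [fall_one_eq_zero hl]
    simpa using h0

theorem Dval_attach_sub_nonneg_and_le (τ : DecTree) {m : ℕ} {T : SimpleGraph (Fin m)}
    (hpos : ∀ x, 0 < deg T x) (v : Fin m) :
    0 ≤ Dval τ (attach T v) - Dval τ T ∧
    (Dval τ (attach T v) - Dval τ T) * deg T v ≤
      (τ.weight + 2 ^ τ.weight) * ∑ u, ∑ ψ : Fin τ.n → Fin m,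
        if ψ u = v ∧ IsWeakHom τ.graph T ψ then powVal τ T ψ else 0 := by
  have hdecomp : Dval τ (attach T v) - Dval τ T =
      (∑ u, ∑ φ : Fin τ.n → Fin m, if IsEmb τ.graph T φ ∧ φ u = v then
        (fall (τ.label u) (deg T (φ u) + 1) - fall (τ.label u) (deg T (φ u))) *
          ∏ x ∈ univ.erase u, fall (τ.label x) (deg T (φ x)) else 0) +
      ∑ u, ∑ ψ : Fin τ.n → Fin m, if ψ u = v then
        attachVal τ.graph (fun x => fall (τ.label x)) T v
          (Function.update (fun x => (ψ x).castSucc) u (Fin.last m)) else 0 := by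
    rw [Dval_eq_embSum, embSum_attach, Dval_eq_embSum, add_sub_right_comm]
    congr 1
    rw [embSum, ← Finset.sum_sub_distrib, Finset.sum_comm]
    refine Finset.sum_congr rfl fun φ _ => ?_
    by_cases hφ : IsEmb τ.graph T φ
    · simp only [hφ, if_true, true_and]
      rw [prod_add_indicator (fun x => fall (τ.label x)) (deg T) hφ.1 v]
      ring
    · simp [hφ]
  rw [hdecomp]
  constructor
  · refine add_nonneg (Finset.sum_nonneg fun u _ => Finset.sum_nonneg fun φ _ => ?_)
      (Finset.sum_nonneg fun u _ => Finset.sum_nonneg fun φ _ => ?_)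
    · split_ifs
      · exact mul_nonneg (fall_diff_nonneg _ _) (Finset.prod_nonneg fun _ _ => fall_nonneg _ _)
      · exact le_rfl
    · split_ifs
      · exact attachVal_nonneg _ (fun _ _ => fall_nonneg _ _) _ _ _
      · exact le_rfl
  · rw [add_mul, add_mul]
    simp only [Finset.sum_mul, Finset.mul_sum]
    refine add_le_add (Finset.sum_le_sum fun u _ => Finset.sum_le_sum fun φ _ => ?_)
      (Finset.sum_le_sum fun u _ => Finset.sum_le_sum fun ψ _ => ?_)
    · by_cases h : IsEmb τ.graph T φ ∧ φ u = v
      · rw [if_pos h, if_pos ⟨h.2, h.1.isWeakHom⟩, powVal,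
          ← Finset.mul_prod_erase univ _ (mem_univ u), mul_right_comm, ← h.2, ← mul_assoc]
        have h1 := fall_diff_mul_le (τ.label_pos u) (deg T (φ u))
        have h2 : (τ.label u : ℝ) ≤ τ.weight := by
          exact_mod_cast Finset.single_le_sum (f := τ.label) (fun _ _ => Nat.zero_le _) (mem_univ u)
        refine mul_le_mul (h1.trans (mul_le_mul_of_nonneg_right h2 (by positivity))) ?_
          (Finset.prod_nonneg fun _ _ => fall_nonneg _ _) (by positivity)
        exact Finset.prod_le_prod (fun _ _ => fall_nonneg _ _) fun x _ => fall_le_pow _ _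
      · rw [if_neg h, zero_mul]
        refine mul_nonneg (by positivity) ?_
        split_ifs
        · exact powVal_nonneg _ _ _
        · exact le_rfl
    · by_cases h : ψ u = v ∧ IsWeakHom τ.graph T ψ
      · rw [if_pos h.1, if_pos h]
        exact attachVal_mul_le τ hpos v u ψ h.1
      · rw [if_neg h, mul_zero]
        by_cases h1 : ψ u = v
        · rw [if_pos h1, attachVal, if_neg, zero_mul]
          exact fun h2 => h ⟨h1, isWeakHom_of_isEmb_update h1 h2⟩
        · rw [if_neg h1, zero_mul]

/-- The conditional second moment of the increments of `D_τ` is controlled by observables of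
weight at most `2 w(τ) - 1`. -/
theorem exists_sum_deg_mul_sq_le (τ : DecTree) :
    ∃ C : ℝ, 0 ≤ C ∧ ∀ {m : ℕ} (T : SimpleGraph (Fin m)), T.IsTree → 2 ≤ m →
      ∑ v, (deg T v : ℝ) * (Dval τ (attach T v) - Dval τ T) ^ 2 ≤
        C * ∑ σ ∈ treesUpTo (2 * τ.weight - 1), Dval σ T := by
  set W := 2 * τ.weight - 1 with hW
  set B : ℝ := (2 * W : ℝ) ^ W with hB
  set c : ℝ := (τ.weight + 2 ^ τ.weight) with hc
  refine ⟨c ^ 2 * (B * (τ.n * τ.n * ((W : ℝ) ^ τ.n * (W : ℝ) ^ τ.n))), by positivity,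
    fun {m} T hT hm => ?_⟩
  have hpos := deg_pos_of_isTree hT hm
  have himg : ∀ A, 0 ≤ imageSum W T A := fun A =>
    Finset.sum_nonneg fun σ _ => Finset.sum_nonneg fun φ _ => by
      split_ifs
      · exact Finset.prod_nonneg fun u _ => fall_nonneg _ _
      · exact le_rfl
  have hterm : ∀ v, (deg T v : ℝ) * (Dval τ (attach T v) - Dval τ T) ^ 2 ≤
      c ^ 2 * (B * ∑ u₁ : Fin τ.n, ∑ _u₂ : Fin τ.n, ∑ ψ₁ : Fin τ.n → Fin m,
        ∑ ψ₂ : Fin τ.n → Fin m,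
          if ψ₁ u₁ = v then imageSum W T (univ.image ψ₁ ∪ univ.image ψ₂) else 0) := by
    intro v
    have hvpos : (0 : ℝ) < deg T v := by exact_mod_cast hpos v
    obtain ⟨h0, h1⟩ := Dval_attach_sub_nonneg_and_le τ hpos v
    set X := Dval τ (attach T v) - Dval τ T
    set Y := ∑ u, ∑ ψ : Fin τ.n → Fin m,
      if ψ u = v ∧ IsWeakHom τ.graph T ψ then powVal τ T ψ else 0 with hY
    have h2 : (X * deg T v) ^ 2 ≤ (c * Y) ^ 2 := pow_le_pow_left₀ (by positivity) h1 2
    have h3 : (deg T v : ℝ) * X ^ 2 ≤ c ^ 2 * (Y * Y / deg T v) := by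
      rw [← mul_div_assoc, le_div_iff₀ hvpos]
      nlinarith
    refine h3.trans (mul_le_mul_of_nonneg_left ?_ (by positivity))
    rw [hY, Finset.sum_mul_sum, Finset.sum_div, Finset.mul_sum]
    refine Finset.sum_le_sum fun u₁ _ => ?_
    rw [Finset.sum_div, Finset.mul_sum]
    refine Finset.sum_le_sum fun u₂ _ => ?_
    rw [Finset.sum_mul_sum, Finset.sum_div, Finset.mul_sum]
    refine Finset.sum_le_sum fun ψ₁ _ => ?_
    rw [Finset.sum_div, Finset.mul_sum]
    refine Finset.sum_le_sum fun ψ₂ _ => ?_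
    by_cases ha : ψ₁ u₁ = v ∧ IsWeakHom τ.graph T ψ₁
    · by_cases hb : ψ₂ u₂ = v ∧ IsWeakHom τ.graph T ψ₂
      · rw [if_pos ha, if_pos hb, if_pos ha.1]
        exact prod_pow_mul_prod_pow_div_le τ hT hm ha.2 hb.2 ha.1 hb.1
      · rw [if_neg hb, mul_zero, zero_div]
        split_ifs
        · exact mul_nonneg (by positivity) (himg _)
        · simp
    · rw [if_neg ha, zero_mul, zero_div]
      split_ifs
      · exact mul_nonneg (by positivity) (himg _)
      · simp
  refine (Finset.sum_le_sum fun v _ => hterm v).trans ?_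
  rw [← Finset.mul_sum, ← Finset.mul_sum, mul_assoc, mul_assoc]
  refine mul_le_mul_of_nonneg_left (mul_le_mul_of_nonneg_left ?_ (by positivity)) (by positivity)
  have hsum : ∑ v, ∑ u₁ : Fin τ.n, ∑ _u₂ : Fin τ.n, ∑ ψ₁ : Fin τ.n → Fin m,
        ∑ ψ₂ : Fin τ.n → Fin m,
          (if ψ₁ u₁ = v then imageSum W T (univ.image ψ₁ ∪ univ.image ψ₂) else 0) =
      τ.n * τ.n * ∑ ψ₁ : Fin τ.n → Fin m, ∑ ψ₂ : Fin τ.n → Fin m,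
        imageSum W T (univ.image ψ₁ ∪ univ.image ψ₂) := by
    have h1 : ∀ u₁ : Fin τ.n, ∑ v, ∑ _u₂ : Fin τ.n, ∑ ψ₁ : Fin τ.n → Fin m,
        ∑ ψ₂ : Fin τ.n → Fin m,
          (if ψ₁ u₁ = v then imageSum W T (univ.image ψ₁ ∪ univ.image ψ₂) else 0) =
        τ.n * ∑ ψ₁ : Fin τ.n → Fin m, ∑ ψ₂ : Fin τ.n → Fin m,
          imageSum W T (univ.image ψ₁ ∪ univ.image ψ₂) := by
      intro u₁
      simp only [Finset.sum_const, Finset.card_univ, Fintype.card_fin, nsmul_eq_mul]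
      rw [← Finset.mul_sum, Finset.sum_comm]
      refine congrArg _ (Finset.sum_congr rfl fun ψ₁ _ => ?_)
      rw [Finset.sum_comm]
      simp
    rw [Finset.sum_comm, Finset.sum_congr rfl fun u₁ _ => h1 u₁, Finset.sum_const]
    simp only [Finset.card_univ, Fintype.card_fin, nsmul_eq_mul, mul_assoc]
  rw [hsum, mul_assoc, mul_assoc, mul_assoc]
  refine mul_le_mul_of_nonneg_left (mul_le_mul_of_nonneg_left ?_ (by positivity)) (by positivity)
  exact sum_imageSum_le τ.n W T

/-- The sum of the weight and the size, a linear extension of `≺`. -/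
def DecTree.rank (τ : DecTree) : ℕ := τ.weight + τ.n

theorem DecTree.lt.rank_lt {σ τ : DecTree} (h : σ.lt τ) : σ.rank < τ.rank := by
  unfold DecTree.rank
  rcases h with h | h <;> omega

theorem DecTree.lt.weight_le {σ τ : DecTree} (h : σ.lt τ) : σ.weight ≤ τ.weight := by
  rcases h with h | h <;> omega

theorem DecTree.lt.trans {σ τ ρ : DecTree} (h : σ.lt τ) (h' : τ.lt ρ) : σ.lt ρ := by
  unfold DecTree.lt at *
  omega

/-- The decorated trees strictly smaller than `τ`. -/
def below (τ : DecTree) : Finset DecTree := (treesUpTo τ.weight).filter fun σ => σ.lt τ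

theorem mem_below {σ τ : DecTree} : σ ∈ below τ ↔ σ.lt τ := by
  rw [below, mem_filter, mem_treesUpTo]
  exact ⟨fun h => h.2, fun h => ⟨h.weight_le, h⟩⟩

/-- Half the growth rate of a decorated tree: the expectation of `D_τ` at time `n` grows like
`n ^ τ.expo`, up to lower order factors. -/
def DecTree.expo (τ : DecTree) : ℝ := (τ.rate : ℝ) / 2

theorem DecTree.one_le_expo (τ : DecTree) : 1 ≤ τ.expo := by
  have : (2 : ℝ) ≤ τ.rate := by exact_mod_cast le_max_right τ.weight 2
  unfold DecTree.expo
  linarith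

theorem DecTree.lt.expo_le {σ τ : DecTree} (h : σ.lt τ) : σ.expo ≤ τ.expo := by
  have : (σ.rate : ℝ) ≤ τ.rate := by exact_mod_cast max_le_max_right 2 h.weight_le
  unfold DecTree.expo
  linarith

theorem DecTree.expo_le_of_weight_le {σ τ : DecTree} (h : σ.weight ≤ 2 * τ.weight - 1) :
    σ.expo ≤ 2 * τ.expo - 1 / 2 := by
  have : (σ.rate : ℝ) + 1 ≤ 2 * τ.rate := by
    have : σ.rate + 1 ≤ 2 * τ.rate := by
      unfold DecTree.rate
      omega
    exact_mod_cast this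
  unfold DecTree.expo
  linarith

/-- The transition operator of the linear preferential attachment chain. -/
def step {m : ℕ} (g : SimpleGraph (Fin (m + 1)) → ℝ) (T : SimpleGraph (Fin m)) : ℝ :=
  ∑ v, (deg T v : ℝ) / (2 * (m : ℝ) - 2) * g (attach T v)

theorem exists_step_Dval :
    ∃ a : DecTree → DecTree → ℝ, ∀ (τ : DecTree) {m : ℕ} (T : SimpleGraph (Fin m)),
      T.IsTree → 2 ≤ m → step (Dval τ) T =
        (1 + τ.expo / ((m : ℝ) - 1)) * Dval τ T +
          ∑ σ ∈ below τ, a τ σ / ((m : ℝ) - 1) * Dval σ T := by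
  have key : ∀ τ : DecTree, ∃ a : DecTree → ℝ, ∀ {m : ℕ} (T : SimpleGraph (Fin m)),
      T.IsTree → 2 ≤ m → step (Dval τ) T =
        (1 + τ.expo / ((m : ℝ) - 1)) * Dval τ T +
          ∑ σ ∈ below τ, a σ / ((m : ℝ) - 1) * Dval σ T := by
    intro τ
    have h := sum_deg_mul_Dval_attach_mem τ
    have hset : {σ : DecTree | σ.lt τ} = ↑(below τ) := by
      ext σ
      simp [mem_below]
    rw [lowerSpan, hset, Submodule.mem_span_image_finset_iff_exists_fun'] at h
    obtain ⟨a, ha⟩ := h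
    refine ⟨fun σ => a σ / 2, fun {m} T hT hm => ?_⟩
    have h1 := congrFun (congrFun ha m) T
    have hm' : (2 : ℝ) ≤ m := by exact_mod_cast hm
    have hm1 : (m : ℝ) - 1 ≠ 0 := by linarith
    have hm2 : 2 * (m : ℝ) - 2 ≠ 0 := by linarith
    simp only [Finset.sum_apply, Pi.smul_apply, smul_eq_mul, dfun, sum_deg_of_isTree hT] at h1
    have h2 : step (Dval τ) T = (∑ v, (deg T v : ℝ) * Dval τ (attach T v)) / (2 * (m : ℝ) - 2) := by
      rw [step, Finset.sum_div]
      exact Finset.sum_congr rfl fun v _ => by ring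
    have h3 : ∑ σ ∈ below τ, a σ / 2 / ((m : ℝ) - 1) * Dval σ T =
        (∑ σ ∈ below τ, a σ * Dval σ T) / (2 * (m : ℝ) - 2) := by
      rw [Finset.sum_div]
      refine Finset.sum_congr rfl fun v _ => ?_
      field_simp
    rw [h2, h3, h1, DecTree.expo]
    field_simp
    ring
  choose a ha using key
  exact ⟨a, fun τ {m} T => ha τ T⟩

/-- The product `∏_{k < n} (1 + a / (k - 1))`, of order `n ^ a`. -/
def growth (a : ℝ) (n : ℕ) : ℝ := ∏ k ∈ Ico 2 n, (1 + a / ((k : ℝ) - 1))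

theorem growth_succ (a : ℝ) {n : ℕ} (hn : 2 ≤ n) :
    growth a (n + 1) = growth a n * (1 + a / ((n : ℝ) - 1)) :=
  Finset.prod_Ico_succ_top hn _

theorem natCast_sub_one_pos {n : ℕ} (hn : 2 ≤ n) : (0 : ℝ) < (n : ℝ) - 1 := by
  have : (2 : ℝ) ≤ n := by exact_mod_cast hn
  linarith

theorem one_add_div_pos {a : ℝ} (ha : 0 ≤ a) {n : ℕ} (hn : 2 ≤ n) :
    0 < 1 + a / ((n : ℝ) - 1) := by
  have := div_nonneg ha (natCast_sub_one_pos hn).le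
  linarith

theorem growth_pos {a : ℝ} (ha : 0 ≤ a) (n : ℕ) : 0 < growth a n :=
  Finset.prod_pos fun _ hk => one_add_div_pos ha (mem_Ico.1 hk).1

theorem growth_le_growth {a b : ℝ} (ha : 0 ≤ a) (hab : a ≤ b) (n : ℕ) :
    growth a n ≤ growth b n :=
  Finset.prod_le_prod (fun _ hk => (one_add_div_pos ha (mem_Ico.1 hk).1).le) fun k hk => by
    have := natCast_sub_one_pos (mem_Ico.1 hk).1
    gcongr

theorem growth_le_succ {a : ℝ} (ha : 0 ≤ a) {n : ℕ} (hn : 2 ≤ n) :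
    growth a n ≤ growth a (n + 1) := by
  rw [growth_succ a hn]
  refine le_mul_of_one_le_right (growth_pos ha n).le ?_
  have := div_nonneg ha (natCast_sub_one_pos hn).le
  linarith

theorem exists_le_mul_growth {x : ℕ → ℝ} {s α B : ℝ} {n₀ : ℕ} (hn₀ : 2 ≤ n₀) (hs : 0 ≤ s)
    (hα : s < α)
    (hx : ∀ n, n₀ ≤ n → x (n + 1) ≤
      (1 + s / ((n : ℝ) - 1)) * x n + B / ((n : ℝ) - 1) * growth α n) :
    ∃ K, 0 ≤ K ∧ ∀ n, n₀ ≤ n → x n ≤ K * growth α n := by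
  have hα0 : 0 ≤ α := hs.trans hα.le
  have hg := growth_pos hα0
  refine ⟨max (|x n₀| / growth α n₀) (B / (α - s)),
    le_max_of_le_left (div_nonneg (abs_nonneg _) (hg _).le), fun n hn => ?_⟩
  set K := max (|x n₀| / growth α n₀) (B / (α - s)) with hK
  have hKB : B ≤ K * (α - s) := by
    rw [← div_le_iff₀ (by linarith)]
    exact le_max_right _ _
  induction n, hn using Nat.le_induction with
  | base =>
    refine (le_abs_self _).trans ?_
    rw [← div_le_iff₀ (hg _)]
    exact le_max_left _ _
  | succ n hn ih =>
    have hn1 := natCast_sub_one_pos (hn₀.trans hn)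
    refine (hx n hn).trans ?_
    rw [growth_succ α (hn₀.trans hn)]
    have h1 := mul_le_mul_of_nonneg_left ih (one_add_div_pos hs (hn₀.trans hn)).le
    have h2 : B / ((n : ℝ) - 1) * growth α n ≤ K * (α - s) / ((n : ℝ) - 1) * growth α n :=
      mul_le_mul_of_nonneg_right (div_le_div_of_nonneg_right hKB hn1.le) (hg n).le
    refine (add_le_add h1 h2).trans (le_of_eq ?_)
    ring

theorem exists_le_div_growth {x : ℕ → ℝ} {s β B : ℝ} (hβ : 0 ≤ β) (hs : β < s)
    (hx : ∀ n, 2 ≤ n → x (n + 1) * (1 + s / ((n : ℝ) - 1)) ≤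
      x n + B / ((n : ℝ) - 1) / growth β (n + 1)) :
    ∃ K, 0 ≤ K ∧ ∀ n, 2 ≤ n → x n ≤ K / growth β n := by
  have hg := growth_pos hβ
  refine ⟨max (|x 2| * growth β 2) (B / (s - β)),
    le_max_of_le_left (mul_nonneg (abs_nonneg _) (hg _).le), fun n hn => ?_⟩
  set K := max (|x 2| * growth β 2) (B / (s - β)) with hK
  have hKB : B ≤ K * (s - β) := by
    rw [← div_le_iff₀ (by linarith)]
    exact le_max_right _ _
  induction n, hn using Nat.le_induction with
  | base =>
    refine (le_abs_self _).trans ?_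
    rw [le_div_iff₀ (hg _)]
    exact le_max_left _ _
  | succ n hn ih =>
    have hn1 := natCast_sub_one_pos hn
    refine le_of_mul_le_mul_right ((hx n hn).trans ?_)
      (one_add_div_pos (hβ.trans hs.le) hn)
    have h1 : x n ≤ K * (1 + β / ((n : ℝ) - 1)) / growth β (n + 1) := by
      rw [growth_succ β hn, mul_div_mul_right _ _ (one_add_div_pos hβ hn).ne']
      exact ih
    have h2 : B / ((n : ℝ) - 1) / growth β (n + 1) ≤
        K * (s - β) / ((n : ℝ) - 1) / growth β (n + 1) :=
      div_le_div_of_nonneg_right (div_le_div_of_nonneg_right hKB hn1.le) (hg _).le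
    refine (add_le_add h1 h2).trans (le_of_eq ?_)
    ring

/-- The ratio `growth (2 s - 3 / 8) / growth (s - 1 / 8) ^ 2`, which decays polynomially. -/
def growthRatio (s : ℝ) (n : ℕ) : ℝ := growth (2 * s - 3 / 8) n / growth (s - 1 / 8) n ^ 2

theorem growthRatio_pos {s : ℝ} (hs : 1 ≤ s) (n : ℕ) : 0 < growthRatio s n :=
  div_pos (growth_pos (by linarith) n) (pow_pos (growth_pos (by linarith) n) 2)

theorem growthRatio_div_le {s : ℝ} (hs : 1 ≤ s) {n : ℕ} (hn : 2 ≤ n) :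
    growthRatio s n / ((n : ℝ) - 1) ≤
      24 * s * (growthRatio s n - growthRatio s (n + 1)) := by
  have hn1 := natCast_sub_one_pos hn
  have hn2 : 1 ≤ (n : ℝ) - 1 := by
    have : (2 : ℝ) ≤ n := by exact_mod_cast hn
    linarith
  have hR := growthRatio_pos hs n
  have hq := one_add_div_pos (show 0 ≤ s - 1 / 8 by linarith) hn
  have h1 : growthRatio s (n + 1) = growthRatio s n *
      ((1 + (2 * s - 3 / 8) / ((n : ℝ) - 1)) / (1 + (s - 1 / 8) / ((n : ℝ) - 1)) ^ 2) := by
    unfold growthRatio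
    rw [growth_succ _ hn, growth_succ _ hn, mul_pow, mul_div_mul_comm]
  have h2 : (1 + (2 * s - 3 / 8) / ((n : ℝ) - 1)) / (1 + (s - 1 / 8) / ((n : ℝ) - 1)) ^ 2 ≤
      1 - 1 / (24 * s * ((n : ℝ) - 1)) := by
    rw [div_le_iff₀ (pow_pos hq 2)]
    set N := (n : ℝ) - 1
    set y := 1 / (24 * s * N) with hy
    have hs0 : 0 < s := by linarith
    have hy0 : 0 < y := by positivity
    have hN : ∀ t : ℝ, t / N = t * (24 * s * y) := fun t => by rw [hy]; field_simp
    have hx1 : 24 * s * y ≤ 1 := by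
      have h6 : 24 * s * y = 1 / N := by rw [hN 1, one_mul]
      rw [h6]
      exact (div_le_one hn1).2 hn2
    rw [hN, hN]
    set x := 24 * s * y with hx
    have hx0 : 0 < x := by positivity
    have h5 : 1 + (2 * s - 1 / 4) * x ≤ (1 + (s - 1 / 8) * x) ^ 2 := by
      nlinarith [sq_nonneg ((s - 1 / 8) * x)]
    have hy1 : 0 ≤ 1 - y := by nlinarith
    refine le_trans ?_ (mul_le_mul_of_nonneg_left h5 hy1)
    nlinarith [mul_nonneg hy0.le (mul_nonneg (show 0 ≤ 2 * s - 1 / 4 by linarith)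
      (show 0 ≤ 1 - x by linarith)), mul_nonneg hy0.le (show 0 ≤ s - 3 / 4 by linarith)]
  rw [h1]
  have h3 := mul_le_mul_of_nonneg_left h2 hR.le
  have h4 : growthRatio s n / ((n : ℝ) - 1) = 24 * s * (growthRatio s n - growthRatio s n *
      (1 - 1 / (24 * s * ((n : ℝ) - 1)))) := by
    field_simp
    ring
  rw [h4]
  gcongr

/-- The decorated trees smaller than or equal to `τ`. -/
def upTo (τ : DecTree) : Finset DecTree := insert τ (below τ)

theorem mem_upTo {σ τ : DecTree} : σ ∈ upTo τ ↔ σ.le τ := by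
  rw [upTo, mem_insert, mem_below, DecTree.le, or_comm]

theorem rank_le_of_mem_upTo {σ τ : DecTree} (h : σ ∈ upTo τ) : σ.rank ≤ τ.rank := by
  rcases mem_upTo.1 h with h | rfl
  · exact h.rank_lt.le
  · exact le_rfl

theorem mem_upTo_of_lt {σ ρ τ : DecTree} (h : σ.lt ρ) (hρ : ρ ∈ upTo τ) : σ ∈ upTo τ := by
  rcases mem_upTo.1 hρ with h' | rfl
  · exact mem_upTo.2 (Or.inl (h.trans h'))
  · exact mem_upTo.2 (Or.inl h)

/-- The decorated trees `i ⪯ τ` with `j ≺ i`. -/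
def between (j τ : DecTree) : Finset DecTree := (upTo τ).filter fun i => j.lt i

theorem rank_lt_of_mem_between {i j τ : DecTree} (h : i ∈ between j τ) :
    j.rank < i.rank ∧ i.rank ≤ τ.rank := by
  rw [between, mem_filter] at h
  exact ⟨h.2.rank_lt, rank_le_of_mem_upTo h.1⟩

theorem between_self (τ : DecTree) : between τ τ = ∅ := by
  refine Finset.eq_empty_of_forall_notMem fun i hi => ?_
  have := rank_lt_of_mem_between hi
  omega

/-- The solution `x` of the triangular system `x j * d j + ∑ i, x i * b i j = y j`, the sum
running over `j ≺ i ⪯ τ`. -/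
def triangularSolve (τ : DecTree) (d : DecTree → ℝ) (b : DecTree → DecTree → ℝ)
    (y : DecTree → ℝ) (j : DecTree) : ℝ :=
  (y j - ∑ i ∈ (between j τ).attach, triangularSolve τ d b y i * b i j) / d j
termination_by τ.rank - j.rank
decreasing_by
  have := rank_lt_of_mem_between i.2
  omega

theorem triangularSolve_spec (τ : DecTree) {d : DecTree → ℝ} (b : DecTree → DecTree → ℝ)
    (y : DecTree → ℝ) {j : DecTree} (hd : d j ≠ 0) :
    triangularSolve τ d b y j * d j + ∑ i ∈ between j τ, triangularSolve τ d b y i * b i j =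
      y j := by
  rw [← Finset.sum_attach (between j τ), triangularSolve, div_mul_cancel₀ _ hd, sub_add_cancel]

/-- The coefficients of the martingale, as a function of the time shifted by `2`. -/
def coeffAux (a : DecTree → DecTree → ℝ) (τ : DecTree) : ℕ → DecTree → ℝ
  | 0 => Pi.single τ 1
  | k + 1 => triangularSolve τ (fun j => 1 + j.expo / (((k + 2 : ℕ) : ℝ) - 1))
      (fun i j => a i j / (((k + 2 : ℕ) : ℝ) - 1)) (coeffAux a τ k)

theorem exists_coeff (a : DecTree → DecTree → ℝ) (τ : DecTree) :
    ∃ c : ℕ → DecTree → ℝ, (∀ n, 2 ≤ n → 0 < c n τ) ∧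
      (∀ n, 2 ≤ n → ∀ j, c (n + 1) j * (1 + j.expo / ((n : ℝ) - 1)) +
        ∑ i ∈ between j τ, c (n + 1) i * (a i j / ((n : ℝ) - 1)) = c n j) := by
  have hrec : ∀ n, 2 ≤ n → ∀ j, coeffAux a τ (n + 1 - 2) j * (1 + j.expo / ((n : ℝ) - 1)) +
      ∑ i ∈ between j τ, coeffAux a τ (n + 1 - 2) i * (a i j / ((n : ℝ) - 1)) =
        coeffAux a τ (n - 2) j := by
    intro n hn j
    obtain ⟨k, rfl⟩ : ∃ k, n = k + 2 := ⟨n - 2, by omega⟩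
    exact triangularSolve_spec τ (fun i j => a i j / (((k + 2 : ℕ) : ℝ) - 1)) (coeffAux a τ k)
      (one_add_div_pos (by linarith [j.one_le_expo]) hn).ne'
  refine ⟨fun n => coeffAux a τ (n - 2), fun n hn => ?_, hrec⟩
  induction n, hn using Nat.le_induction with
  | base => simp [coeffAux]
  | succ n hn ih =>
    have h := hrec n hn τ
    rw [between_self, Finset.sum_empty, add_zero] at h
    change 0 < coeffAux a τ (n - 2) τ at ih
    refine (pos_iff_pos_of_mul_pos (h.symm ▸ ih)).2 ?_
    exact one_add_div_pos (by linarith [τ.one_le_expo]) hn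

theorem exists_abs_coeff_le {a : DecTree → DecTree → ℝ} {τ : DecTree} {c : ℕ → DecTree → ℝ}
    (hc : ∀ n, 2 ≤ n → ∀ j, c (n + 1) j * (1 + j.expo / ((n : ℝ) - 1)) +
        ∑ i ∈ between j τ, c (n + 1) i * (a i j / ((n : ℝ) - 1)) = c n j) (j : DecTree) :
    ∃ K, 0 ≤ K ∧ ∀ n, 2 ≤ n → |c n j| ≤ K / growth (j.expo - 1 / 8) n := by
  induction hr : τ.rank - j.rank using Nat.strong_induction_on generalizing j with
  | _ r ih =>
  have ih' : ∀ i ∈ between j τ, ∃ K, 0 ≤ K ∧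
      ∀ n, 2 ≤ n → |c n i| ≤ K / growth (i.expo - 1 / 8) n := fun i hi => by
    have := rank_lt_of_mem_between hi
    exact ih _ (by omega) i rfl
  choose! K hK0 hK using ih'
  have hj := j.one_le_expo
  refine exists_le_div_growth (s := j.expo) (B := ∑ i ∈ between j τ, K i * |a i j|)
    (by linarith) (by linarith) fun n hn => ?_
  have hn1 := natCast_sub_one_pos hn
  have hd := one_add_div_pos (show 0 ≤ j.expo by linarith) hn
  have h1 : c (n + 1) j * (1 + j.expo / ((n : ℝ) - 1)) =
      c n j - ∑ i ∈ between j τ, c (n + 1) i * (a i j / ((n : ℝ) - 1)) := by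
    rw [← hc n hn j]
    ring
  rw [← abs_of_pos hd, ← abs_mul, h1]
  refine (abs_sub _ _).trans (add_le_add_right ?_ _)
  refine (Finset.abs_sum_le_sum_abs _ _).trans ?_
  rw [Finset.sum_div, Finset.sum_div]
  refine Finset.sum_le_sum fun i hi => ?_
  have hlt : j.lt i := (mem_filter.1 hi).2
  rw [abs_mul, abs_div, abs_of_pos hn1]
  have h2 : |c (n + 1) i| ≤ K i / growth (j.expo - 1 / 8) (n + 1) := by
    refine (hK i hi (n + 1) (by omega)).trans (div_le_div_of_nonneg_left (hK0 i hi) ?_ ?_)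
    · exact growth_pos (by linarith) _
    · exact growth_le_growth (by linarith) (by linarith [hlt.expo_le]) _
  refine (mul_le_mul_of_nonneg_right h2 (by positivity)).trans (le_of_eq ?_)
  ring

theorem step_sum {m : ℕ} {ι : Type*} (s : Finset ι) (c : ι → ℝ)
    (g : ι → SimpleGraph (Fin (m + 1)) → ℝ) (T : SimpleGraph (Fin m)) :
    step (fun G => ∑ i ∈ s, c i * g i G) T = ∑ i ∈ s, c i * step (g i) T := by
  unfold step
  simp only [Finset.mul_sum]
  rw [Finset.sum_comm]
  exact Finset.sum_congr rfl fun _ _ => Finset.sum_congr rfl fun _ _ => by ring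

theorem step_observable {a : DecTree → DecTree → ℝ} {τ : DecTree} {c : ℕ → DecTree → ℝ}
    (ha : ∀ (τ : DecTree) {m : ℕ} (T : SimpleGraph (Fin m)),
      T.IsTree → 2 ≤ m → step (Dval τ) T =
        (1 + τ.expo / ((m : ℝ) - 1)) * Dval τ T +
          ∑ σ ∈ below τ, a τ σ / ((m : ℝ) - 1) * Dval σ T)
    (hc : ∀ n, 2 ≤ n → ∀ j, c (n + 1) j * (1 + j.expo / ((n : ℝ) - 1)) +
        ∑ i ∈ between j τ, c (n + 1) i * (a i j / ((n : ℝ) - 1)) = c n j)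
    {m : ℕ} {T : SimpleGraph (Fin m)} (hT : T.IsTree) (hm : 2 ≤ m) :
    step (fun G => ∑ σ ∈ upTo τ, c (m + 1) σ * Dval σ G) T = ∑ σ ∈ upTo τ, c m σ * Dval σ T := by
  rw [step_sum (upTo τ) (c (m + 1)) fun σ => Dval σ]
  have h1 : ∀ σ ∈ upTo τ, c m σ * Dval σ T =
      c (m + 1) σ * ((1 + σ.expo / ((m : ℝ) - 1)) * Dval σ T) +
        ∑ i ∈ between σ τ, c (m + 1) i * (a i σ / ((m : ℝ) - 1) * Dval σ T) := fun σ _ => by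
    rw [← hc m hm σ, add_mul, Finset.sum_mul]
    exact congrArg₂ _ (by ring) (Finset.sum_congr rfl fun _ _ => by ring)
  rw [Finset.sum_congr rfl h1, Finset.sum_add_distrib]
  simp only [ha _ T hT hm, mul_add, Finset.sum_add_distrib, Finset.mul_sum]
  congr 1
  refine Finset.sum_comm' fun i σ => ?_
  rw [between, mem_filter, mem_below]
  exact ⟨fun h => ⟨h, mem_upTo_of_lt h.2 h.1⟩, fun h => h.1⟩

theorem step_sq_le {m : ℕ} {T : SimpleGraph (Fin m)} (hT : T.IsTree) (hm : 2 ≤ m)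
    (g : SimpleGraph (Fin (m + 1)) → ℝ) (x : ℝ) :
    step (fun G => g G ^ 2) T ≤ step g T ^ 2 + step (fun G => (g G - x) ^ 2) T := by
  have hm1 := natCast_sub_one_pos hm
  have hp : ∑ v, (deg T v : ℝ) / (2 * (m : ℝ) - 2) = 1 := by
    rw [← Finset.sum_div, sum_deg_of_isTree hT, div_self]
    linarith
  have h : step (fun G => (g G - x) ^ 2) T =
      step (fun G => g G ^ 2) T - 2 * x * step g T + x ^ 2 := by
    rw [← mul_one (x ^ 2), ← hp]
    unfold step
    rw [Finset.mul_sum, Finset.mul_sum, ← Finset.sum_sub_distrib, ← Finset.sum_add_distrib]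
    exact Finset.sum_congr rfl fun _ _ => by ring
  rw [h]
  nlinarith [sq_nonneg (step g T - x)]

theorem step_mono {m : ℕ} {T : SimpleGraph (Fin m)} (hm : 2 ≤ m)
    {f g : SimpleGraph (Fin (m + 1)) → ℝ} (h : ∀ v, f (attach T v) ≤ g (attach T v)) :
    step f T ≤ step g T := by
  have hm1 := natCast_sub_one_pos hm
  refine Finset.sum_le_sum fun v _ => mul_le_mul_of_nonneg_left (h v) ?_
  exact div_nonneg (Nat.cast_nonneg _) (by linarith)

theorem exists_step_observable_sq_le (τ : DecTree) :
    ∃ C : DecTree → ℝ, (∀ σ, 0 ≤ C σ) ∧ ∀ (c : DecTree → ℝ) {m : ℕ} {T : SimpleGraph (Fin m)},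
      T.IsTree → 2 ≤ m →
      step (fun G => (∑ σ ∈ upTo τ, c σ * Dval σ G) ^ 2) T ≤
        step (fun G => ∑ σ ∈ upTo τ, c σ * Dval σ G) T ^ 2 +
          ∑ σ ∈ upTo τ, c σ ^ 2 * (C σ / ((m : ℝ) - 1)) *
            ∑ ρ ∈ treesUpTo (2 * σ.weight - 1), Dval ρ T := by
  choose C hC0 hC using exists_sum_deg_mul_sq_le
  refine ⟨fun σ => #(upTo τ) * C σ / 2, fun σ => by have := hC0 σ; positivity,
    fun c {m T} hT hm => ?_⟩
  have hm1 := natCast_sub_one_pos hm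
  refine (step_sq_le hT hm _ (∑ σ ∈ upTo τ, c σ * Dval σ T)).trans ?_
  refine add_le_add_right ?_ _
  have h1 : step (fun G => (∑ σ ∈ upTo τ, c σ * Dval σ G - ∑ σ ∈ upTo τ, c σ * Dval σ T) ^ 2) T ≤
      step (fun G => ∑ σ ∈ upTo τ, #(upTo τ) * c σ ^ 2 * (Dval σ G - Dval σ T) ^ 2) T := by
    refine step_mono hm fun v => ?_
    rw [← Finset.sum_sub_distrib]
    refine sq_sum_le_card_mul_sum_sq.trans ?_
    rw [Finset.mul_sum]
    exact Finset.sum_le_sum fun σ _ => le_of_eq (by ring)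
  refine h1.trans ?_
  rw [step_sum (upTo τ) (fun σ => #(upTo τ) * c σ ^ 2) fun σ G => (Dval σ G - Dval σ T) ^ 2]
  refine Finset.sum_le_sum fun σ _ => ?_
  have h2 : step (fun G => (Dval σ G - Dval σ T) ^ 2) T =
      (∑ v, (deg T v : ℝ) * (Dval σ (attach T v) - Dval σ T) ^ 2) / (2 * ((m : ℝ) - 1)) := by
    rw [step, Finset.sum_div]
    exact Finset.sum_congr rfl fun v _ => by ring
  rw [h2]
  refine (mul_le_mul_of_nonneg_left (div_le_div_of_nonneg_right (hC σ T hT hm) (by positivity))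
    (by positivity)).trans (le_of_eq ?_)
  field_simp

section Chain

variable {n₀ : ℕ} {S : SimpleGraph (Fin n₀)} {Ω : Type*} {mΩ : MeasurableSpace Ω}
  {μ : Measure Ω} {F : Filtration ℕ mΩ} {T : (n : ℕ) → Ω → SimpleGraph (Fin n)}

theorem IsLPAMChain.measurable (h : IsLPAMChain S μ F T) (n : ℕ) : Measurable (T n) :=
  (h.1 n).mono (F.le n) le_rfl

theorem IsLPAMChain.stronglyMeasurable_comp (h : IsLPAMChain S μ F T) (n : ℕ)
    (g : SimpleGraph (Fin n) → ℝ) : StronglyMeasurable[F n] fun ω => g (T n ω) :=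
  ((measurable_from_top (f := g)).comp (h.1 n)).stronglyMeasurable

theorem IsLPAMChain.integrable_comp [IsProbabilityMeasure μ] (h : IsLPAMChain S μ F T) (n : ℕ)
    (g : SimpleGraph (Fin n) → ℝ) : Integrable (fun ω => g (T n ω)) μ := by
  refine Integrable.of_bound
    ((h.stronglyMeasurable_comp n g).mono (F.le n)).aestronglyMeasurable (∑ G, |g G|) ?_
  exact Filter.Eventually.of_forall fun ω =>
    Finset.single_le_sum (f := fun G => |g G|) (fun _ _ => abs_nonneg _) (mem_univ (T n ω))

theorem IsLPAMChain.setIntegral_comp [IsProbabilityMeasure μ] (h : IsLPAMChain S μ F T) (n : ℕ)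
    (g : SimpleGraph (Fin n) → ℝ) (A : Set Ω) :
    ∫ ω in A, g (T n ω) ∂μ = ∑ G, μ.real (A ∩ {ω | T n ω = G}) * g G := by
  have hT := h.measurable n
  rw [← integral_map (f := g) hT.aemeasurable measurable_from_top.aestronglyMeasurable,
    integral_fintype (Integrable.of_finite)]
  refine Finset.sum_congr rfl fun G _ => ?_
  have hG : MeasurableSet (T n ⁻¹' {G}) := hT trivial
  rw [smul_eq_mul, map_measureReal_apply hT trivial, measureReal_restrict_apply hG, Set.inter_comm]
  rfl

theorem IsLPAMChain.setIntegral_succ [IsProbabilityMeasure μ] (h : IsLPAMChain S μ F T) {n : ℕ}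
    (hn : n₀ ≤ n) (hn2 : 2 ≤ n) (g : SimpleGraph (Fin (n + 1)) → ℝ) {A : Set Ω}
    (hA : MeasurableSet[F n] A) :
    ∫ ω in A, g (T (n + 1) ω) ∂μ = ∫ ω in A, step g (T n ω) ∂μ := by
  have hn1 := natCast_sub_one_pos hn2
  rw [h.setIntegral_comp (n + 1), h.setIntegral_comp n]
  have h1 : ∀ G', μ.real (A ∩ {ω | T (n + 1) ω = G'}) =
      ∑ H : SimpleGraph (Fin n), ∑ v : Fin n,
        (if attach H v = G' then (deg H v : ℝ) / (2 * (n : ℝ) - 2) else 0) *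
          μ.real (A ∩ {ω | T n ω = H}) := by
    intro G'
    have hfin : ∀ (H : SimpleGraph (Fin n)) (v : Fin n),
        (if attach H v = G' then ENNReal.ofReal ((deg H v : ℝ) / (2 * (n : ℝ) - 2)) else 0) *
          μ (A ∩ {ω | T n ω = H}) ≠ ⊤ := fun H v =>
      ENNReal.mul_ne_top (by split_ifs <;> simp) (measure_ne_top _ _)
    rw [Measure.real, h.2.2 n hn A hA G',
      ENNReal.toReal_sum fun H _ => (ENNReal.sum_lt_top.2 fun v _ => (hfin H v).lt_top).ne]
    refine Finset.sum_congr rfl fun H _ => ?_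
    rw [ENNReal.toReal_sum fun v _ => hfin H v]
    refine Finset.sum_congr rfl fun v _ => ?_
    rw [ENNReal.toReal_mul, Measure.real]
    congr 1
    split_ifs
    · exact ENNReal.toReal_ofReal (div_nonneg (Nat.cast_nonneg _) (by linarith))
    · rfl
  simp only [h1, Finset.sum_mul, step, Finset.mul_sum]
  rw [Finset.sum_comm]
  refine Finset.sum_congr rfl fun H _ => ?_
  rw [Finset.sum_comm]
  refine Finset.sum_congr rfl fun v _ => ?_
  rw [Finset.sum_eq_single (attach H v)]
  · rw [if_pos rfl]
    ring
  · intro G' _ hG'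
    rw [if_neg hG'.symm]
    ring
  · simp

theorem IsLPAMChain.ae_isTree (h : IsLPAMChain S μ F T) (hS : S.IsTree) {n : ℕ} (hn : n₀ ≤ n) :
    ∀ᵐ ω ∂μ, (T n ω).IsTree := by
  suffices hnull : ∀ G : SimpleGraph (Fin n), ¬ G.IsTree → μ {ω | T n ω = G} = 0 by
    have : ∀ᵐ ω ∂μ, ∀ G : SimpleGraph (Fin n), ¬ G.IsTree → T n ω ≠ G :=
      ae_all_iff.2 fun G => by
        by_cases hG : G.IsTree
        · simp [hG]
        · simpa [hG, ae_iff] using hnull G hG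
    filter_upwards [this] with ω hω
    by_contra hc
    exact hω _ hc rfl
  induction n, hn using Nat.le_induction with
  | base =>
    intro G hG
    have : ∀ᵐ ω ∂μ, T n₀ ω ≠ G := by
      filter_upwards [h.2.1] with ω hω
      rintro rfl
      exact hG (hω ▸ hS)
    simpa [ae_iff] using this
  | succ n hn ih =>
    intro G hG
    have := h.2.2 n hn Set.univ MeasurableSet.univ G
    simp only [Set.univ_inter] at this
    rw [this]
    refine Finset.sum_eq_zero fun H _ => Finset.sum_eq_zero fun v _ => ?_
    by_cases hH : H.IsTree
    · rw [if_neg, zero_mul]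
      rintro rfl
      exact hG (isTree_attach hH v)
    · rw [ih H hH, mul_zero]

theorem IsLPAMChain.condExp_succ [IsProbabilityMeasure μ] (h : IsLPAMChain S μ F T) {n : ℕ}
    (hn : n₀ ≤ n) (hn2 : 2 ≤ n) (g : SimpleGraph (Fin (n + 1)) → ℝ) :
    μ[fun ω => g (T (n + 1) ω) | F n] =ᵐ[μ] fun ω => step g (T n ω) := by
  refine (ae_eq_condExp_of_forall_setIntegral_eq (F.le n) (h.integrable_comp (n + 1) g)
    (fun _ _ _ => (h.integrable_comp n (step g)).integrableOn)
    (fun A hA _ => (h.setIntegral_succ hn hn2 g hA).symm) ?_).symm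
  exact (h.stronglyMeasurable_comp n (step g)).aestronglyMeasurable

theorem IsLPAMChain.integral_succ [IsProbabilityMeasure μ] (h : IsLPAMChain S μ F T) {n : ℕ}
    (hn : n₀ ≤ n) (hn2 : 2 ≤ n) (g : SimpleGraph (Fin (n + 1)) → ℝ) :
    ∫ ω, g (T (n + 1) ω) ∂μ = ∫ ω, step g (T n ω) ∂μ := by
  simpa using h.setIntegral_succ hn hn2 g MeasurableSet.univ

theorem IsLPAMChain.exists_integral_Dval_le [IsProbabilityMeasure μ] (h : IsLPAMChain S μ F T)
    (hS : S.IsTree) (hn₀ : 2 ≤ n₀) (σ : DecTree) :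
    ∃ K, 0 ≤ K ∧ ∀ n, n₀ ≤ n → ∫ ω, Dval σ (T n ω) ∂μ ≤ K * growth (σ.expo + 1 / 8) n := by
  obtain ⟨a, ha⟩ := exists_step_Dval
  induction hr : σ.rank using Nat.strong_induction_on generalizing σ with
  | _ r ih =>
  have ih' : ∀ ρ ∈ below σ, ∃ K, 0 ≤ K ∧
      ∀ n, n₀ ≤ n → ∫ ω, Dval ρ (T n ω) ∂μ ≤ K * growth (ρ.expo + 1 / 8) n := fun ρ hρ =>
    ih _ (hr ▸ (mem_below.1 hρ).rank_lt) ρ rfl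
  choose! K hK0 hK using ih'
  have hσ := σ.one_le_expo
  refine exists_le_mul_growth (s := σ.expo) (B := ∑ ρ ∈ below σ, |a σ ρ| * K ρ) hn₀
    (by linarith) (by linarith) fun n hn => ?_
  have hn2 := hn₀.trans hn
  have hn1 := natCast_sub_one_pos hn2
  rw [h.integral_succ hn hn2]
  have h1 : ∫ ω, step (Dval σ) (T n ω) ∂μ = ∫ ω, ((1 + σ.expo / ((n : ℝ) - 1)) * Dval σ (T n ω) +
          ∑ ρ ∈ below σ, a σ ρ / ((n : ℝ) - 1) * Dval ρ (T n ω)) ∂μ := by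
    refine integral_congr_ae ?_
    filter_upwards [h.ae_isTree hS hn] with ω hω
    exact ha σ (T n ω) hω hn2
  rw [h1, integral_add ((h.integrable_comp n _).const_mul _)
    (integrable_finsetSum _ fun ρ _ => (h.integrable_comp n _).const_mul _),
    integral_finsetSum _ fun ρ _ => (h.integrable_comp n _).const_mul _, integral_const_mul]
  refine add_le_add_right ?_ _
  rw [Finset.sum_div, Finset.sum_mul]
  refine Finset.sum_le_sum fun ρ hρ => ?_
  have hρ0 := ρ.one_le_expo
  have hpos : 0 ≤ ∫ ω, Dval ρ (T n ω) ∂μ := integral_nonneg fun ω => Dval_nonneg _ _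
  have h2 : ∫ ω, Dval ρ (T n ω) ∂μ ≤ K ρ * growth (σ.expo + 1 / 8) n :=
    (hK ρ hρ n hn).trans (mul_le_mul_of_nonneg_left
      (growth_le_growth (by linarith) (by linarith [(mem_below.1 hρ).expo_le]) n) (hK0 ρ hρ))
  rw [integral_const_mul]
  refine (mul_le_mul (div_le_div_of_nonneg_right (le_abs_self _) hn1.le) h2 hpos
    (by positivity)).trans (le_of_eq (by ring))

theorem IsLPAMChain.exists_integral_sq_le [IsProbabilityMeasure μ] (h : IsLPAMChain S μ F T)
    (hS : S.IsTree) (hn₀ : 2 ≤ n₀) {τ : DecTree} {c : ℕ → DecTree → ℝ}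
    (hstep : ∀ {m : ℕ} {T : SimpleGraph (Fin m)}, T.IsTree → 2 ≤ m →
      step (fun G => ∑ σ ∈ upTo τ, c (m + 1) σ * Dval σ G) T =
        ∑ σ ∈ upTo τ, c m σ * Dval σ T)
    (hc : ∀ j : DecTree, ∃ K, 0 ≤ K ∧ ∀ n, 2 ≤ n → |c n j| ≤ K / growth (j.expo - 1 / 8) n) :
    ∃ C : ℝ, ∀ n, n₀ ≤ n → ∫ ω, (∑ σ ∈ upTo τ, c n σ * Dval σ (T n ω)) ^ 2 ∂μ ≤ C := by
  obtain ⟨C, hC0, hC⟩ := exists_step_observable_sq_le τ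
  choose K hK0 hK using hc
  choose L hL0 hL using fun σ => h.exists_integral_Dval_le hS hn₀ σ
  set V : ℕ → ℝ := fun n => ∫ ω, (∑ σ ∈ upTo τ, c n σ * Dval σ (T n ω)) ^ 2 ∂μ with hV
  set B : DecTree → ℝ := fun σ => K σ ^ 2 * C σ * (∑ ρ ∈ treesUpTo (2 * σ.weight - 1), L ρ) *
    (24 * σ.expo) with hB
  have hB0 : ∀ σ, 0 ≤ B σ := fun σ => by
    have := σ.one_le_expo
    exact mul_nonneg (mul_nonneg (mul_nonneg (sq_nonneg _) (hC0 σ))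
      (Finset.sum_nonneg fun ρ _ => hL0 ρ)) (by linarith)
  set R : ℕ → ℝ := fun n => ∑ σ ∈ upTo τ, B σ * growthRatio σ.expo n with hR
  have hR0 : ∀ n, 0 ≤ R n := fun n => Finset.sum_nonneg fun σ _ =>
    mul_nonneg (hB0 σ) (growthRatio_pos σ.one_le_expo n).le
  have hterm : ∀ n, n₀ ≤ n → ∀ σ, c (n + 1) σ ^ 2 * (C σ / ((n : ℝ) - 1)) *
      ∑ ρ ∈ treesUpTo (2 * σ.weight - 1), ∫ ω, Dval ρ (T n ω) ∂μ ≤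
        B σ * (growthRatio σ.expo n - growthRatio σ.expo (n + 1)) := by
    intro n hn σ
    have hn2 := hn₀.trans hn
    have hn1 := natCast_sub_one_pos hn2
    have hσ := σ.one_le_expo
    have hg : 0 < growth (σ.expo - 1 / 8) n := growth_pos (by linarith) n
    have h1 : c (n + 1) σ ^ 2 ≤ K σ ^ 2 / growth (σ.expo - 1 / 8) n ^ 2 := by
      rw [← sq_abs, ← div_pow]
      refine pow_le_pow_left₀ (abs_nonneg _) ((hK σ (n + 1) (by omega)).trans ?_) 2
      exact div_le_div_of_nonneg_left (hK0 σ) hg (growth_le_succ (by linarith) hn2)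
    have h2 : ∑ ρ ∈ treesUpTo (2 * σ.weight - 1), ∫ ω, Dval ρ (T n ω) ∂μ ≤
        (∑ ρ ∈ treesUpTo (2 * σ.weight - 1), L ρ) * growth (2 * σ.expo - 3 / 8) n := by
      rw [Finset.sum_mul]
      refine Finset.sum_le_sum fun ρ hρ => (hL ρ n hn).trans
        (mul_le_mul_of_nonneg_left (growth_le_growth ?_ ?_ n) (hL0 ρ))
      · linarith [ρ.one_le_expo]
      · linarith [DecTree.expo_le_of_weight_le (mem_treesUpTo.1 hρ)]
    have hCn : 0 ≤ C σ / ((n : ℝ) - 1) := div_nonneg (hC0 σ) hn1.le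
    have h3 := mul_le_mul (mul_le_mul_of_nonneg_right h1 hCn) h2
      (Finset.sum_nonneg fun ρ _ => integral_nonneg fun ω => Dval_nonneg _ _) (by positivity)
    refine h3.trans ?_
    have h4 := mul_le_mul_of_nonneg_left (growthRatio_div_le hσ hn2)
      (mul_nonneg (mul_nonneg (sq_nonneg (K σ)) (hC0 σ))
        (Finset.sum_nonneg fun ρ (_ : ρ ∈ treesUpTo (2 * σ.weight - 1)) => hL0 ρ))
    refine (le_of_eq ?_).trans (h4.trans (le_of_eq ?_))
    · unfold growthRatio
      ring
    · rw [hB]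
      ring
  have hsucc : ∀ n, n₀ ≤ n → V (n + 1) + R (n + 1) ≤ V n + R n := by
    intro n hn
    have hn2 := hn₀.trans hn
    have h1 : V (n + 1) ≤ ∫ ω, ((∑ σ ∈ upTo τ, c n σ * Dval σ (T n ω)) ^ 2 +
        ∑ σ ∈ upTo τ, c (n + 1) σ ^ 2 * (C σ / ((n : ℝ) - 1)) *
          ∑ ρ ∈ treesUpTo (2 * σ.weight - 1), Dval ρ (T n ω)) ∂μ := by
      rw [hV]
      beta_reduce
      rw [h.integral_succ hn hn2 fun G => (∑ σ ∈ upTo τ, c (n + 1) σ * Dval σ G) ^ 2]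
      refine integral_mono_ae (h.integrable_comp n _) (h.integrable_comp n fun G =>
        (∑ σ ∈ upTo τ, c n σ * Dval σ G) ^ 2 +
        ∑ σ ∈ upTo τ, c (n + 1) σ ^ 2 * (C σ / ((n : ℝ) - 1)) *
          ∑ ρ ∈ treesUpTo (2 * σ.weight - 1), Dval ρ G) ?_
      filter_upwards [h.ae_isTree hS hn] with ω hω
      refine (hC (c (n + 1)) hω hn2).trans ?_
      rw [hstep hω hn2]
    rw [integral_add (h.integrable_comp n fun G => (∑ σ ∈ upTo τ, c n σ * Dval σ G) ^ 2)
      (h.integrable_comp n fun G => ∑ σ ∈ upTo τ, c (n + 1) σ ^ 2 * (C σ / ((n : ℝ) - 1)) *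
          ∑ ρ ∈ treesUpTo (2 * σ.weight - 1), Dval ρ G),
      integral_finsetSum _ fun σ _ => h.integrable_comp n fun G =>
        c (n + 1) σ ^ 2 * (C σ / ((n : ℝ) - 1)) *
          ∑ ρ ∈ treesUpTo (2 * σ.weight - 1), Dval ρ G] at h1
    have h2 : ∀ σ ∈ upTo τ, ∫ ω, c (n + 1) σ ^ 2 * (C σ / ((n : ℝ) - 1)) *
          ∑ ρ ∈ treesUpTo (2 * σ.weight - 1), Dval ρ (T n ω) ∂μ ≤
        B σ * growthRatio σ.expo n - B σ * growthRatio σ.expo (n + 1) := fun σ _ => by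
      rw [integral_const_mul, integral_finsetSum _ fun ρ _ => h.integrable_comp n _, ← mul_sub]
      exact hterm n hn σ
    have h3 := Finset.sum_le_sum h2
    rw [Finset.sum_sub_distrib] at h3
    change V (n + 1) ≤ V n + _ at h1
    change _ ≤ R n - R (n + 1) at h3
    linarith
  refine ⟨V n₀ + R n₀, fun n hn => (le_add_of_nonneg_right (hR0 n)).trans ?_⟩
  induction n, hn using Nat.le_induction with
  | base => exact le_rfl
  | succ n hn ih => exact (hsucc n hn).trans ih

end Chain

/-- **Proposition 5.** For every decorated tree `τ` there exist real constants
`{c_n(τ,τ') : τ' ⪯ τ, n ≥ 2}` with `c_n(τ,τ) > 0`, not depending on the seed, such that for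
every seed tree `S` with `|S| = n₀ ≥ 2`, the process
`M_τ^{(S)}(n) = ∑_{τ' ⪯ τ} c_n(τ,τ') D_{τ'}(T_n^{(S)})`, for `n ≥ n₀`, is a martingale with
respect to the filtration `F_n = σ(T_{n₀}^{(S)},…,T_n^{(S)})` and is bounded in `L²`. -/
theorem martingale_observables (τ : DecTree) :
    ∃ (ts : Finset DecTree) (c : ℕ → DecTree → ℝ),
      (∀ τ' ∈ ts, DecTree.le τ' τ) ∧ τ ∈ ts ∧ (∀ n, 2 ≤ n → 0 < c n τ) ∧
      ∀ {n₀ : ℕ} (S : SimpleGraph (Fin n₀)), S.IsTree → 2 ≤ n₀ →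
      ∀ {Ω : Type} {mΩ : MeasurableSpace Ω} (μ : Measure Ω), IsProbabilityMeasure μ →
      ∀ (F : Filtration ℕ mΩ) (T : (n : ℕ) → Ω → SimpleGraph (Fin n)),
        IsLPAMChain S μ F T →
        (∀ n, n₀ ≤ n →
          StronglyMeasurable[F n] fun ω => ∑ τ' ∈ ts, c n τ' * Dval τ' (T n ω)) ∧
        (∀ n, n₀ ≤ n →
          Integrable (fun ω => ∑ τ' ∈ ts, c n τ' * Dval τ' (T n ω)) μ) ∧
        (∀ n, n₀ ≤ n →
          μ[(fun ω => ∑ τ' ∈ ts, c (n + 1) τ' * Dval τ' (T (n + 1) ω)) | F n] =ᵐ[μ]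
            fun ω => ∑ τ' ∈ ts, c n τ' * Dval τ' (T n ω)) ∧
        ∃ C : ℝ, ∀ n, n₀ ≤ n →
          ∫ ω, (∑ τ' ∈ ts, c n τ' * Dval τ' (T n ω)) ^ 2 ∂μ ≤ C := by
  obtain ⟨a, ha⟩ := exists_step_Dval
  obtain ⟨c, hpos, hc⟩ := exists_coeff a τ
  refine ⟨upTo τ, c, fun σ hσ => mem_upTo.1 hσ, mem_insert_self _ _, hpos, ?_⟩
  intro n₀ S hS hn₀ Ω mΩ μ hμ F T h
  refine ⟨fun n _ => h.stronglyMeasurable_comp n fun G => ∑ σ ∈ upTo τ, c n σ * Dval σ G,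
    fun n _ => h.integrable_comp n fun G => ∑ σ ∈ upTo τ, c n σ * Dval σ G, fun n hn => ?_,
    h.exists_integral_sq_le hS hn₀ (fun hT hm => step_observable ha hc hT hm)
      (exists_abs_coeff_le hc)⟩
  refine (h.condExp_succ hn (hn₀.trans hn) fun G =>
    ∑ σ ∈ upTo τ, c (n + 1) σ * Dval σ G).trans ?_
  filter_upwards [h.ae_isTree hS hn] with ω hω
  exact step_observable ha hc hω (hn₀.trans hn)

end LPAM
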